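/- Let Q be the barrel partition of ℝ⁸. Then its defect equals Δ_Q = 8^{1/4} · √π · (4 − (8/7)√2) ≈ 7.10. -/

import Mathlib

open MeasureTheory Metric Set Filter Topology
open scoped ENNReal symmDiff RealInnerProductSpace

noncomputable section

/-- `d`-dimensional Euclidean space. -/
abbrev Euc (d : ℕ) : Type := EuclideanSpace ℝ (Fin d)

/-- The divergence of a vector field `φ : ℝ^d → ℝ^d`. -/
def vdiv {d : ℕ} (φ : Euc d → Euc d) (x : Euc d) : ℝ :=
  ∑ i, fderiv ℝ φ x (EuclideanSpace.single i 1) i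

/-- The perimeter `Per(E, B) = |D 1_E|(B)` of `E` relative to `B`, defined as the
outer-regularized total variation (on `B`) of the distributional derivative of the
characteristic function of `E`. -/
def perim {d : ℕ} (E B : Set (Euc d)) : ℝ≥0∞ :=
  ⨅ (U : Set (Euc d)) (_ : IsOpen U) (_ : B ⊆ U),
    ⨆ (φ : Euc d → Euc d) (_ : ContDiff ℝ 1 φ) (_ : HasCompactSupport φ)
      (_ : tsupport φ ⊆ U) (_ : ∀ x, ‖φ x‖ ≤ 1),
      ENNReal.ofReal (∫ x in E, vdiv φ x)

/-- A Caccioppoli set: a measurable set with locally finite perimeter. -/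
def Caccioppoli {d : ℕ} (E : Set (Euc d)) : Prop :=
  MeasurableSet E ∧ ∀ r : ℝ, 0 < r → perim E (ball 0 r) < ⊤

/-- An `N`-partition of `ℝ^d`: measurable regions, pairwise Lebesgue-disjoint,
whose union has full measure. -/
structure IsPartition {d N : ℕ} (E : Fin N → Set (Euc d)) : Prop where
  meas : ∀ j, MeasurableSet (E j)
  disj : ∀ i j, i ≠ j → volume (E i ∩ E j) = 0
  full : volume ((univ : Set (Euc d)) \ ⋃ j, E j) = 0

/-- Perimeter of a partition in `B`: half the sum of the perimeters of the regions. -/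
def partPerim {d N : ℕ} (E : Fin N → Set (Euc d)) (B : Set (Euc d)) : ℝ≥0∞ :=
  (∑ k, perim (E k) B) / 2

/-- `E` is `J`-isoperimetric in the (closed) set `X`. -/
def IsJIsoperimetric {d N : ℕ} (E : Fin N → Set (Euc d)) (X : Set (Euc d))
    (J : Set (Fin N)) : Prop :=
  ∀ K : Set (Euc d), IsCompact K → K ⊆ X →
    ∀ F : Fin N → Set (Euc d), IsPartition F →
      (∀ j, (F j) ∆ (E j) ⊆ K) →
      (∀ j ∈ J, volume (F j ∩ K) = volume (E j ∩ K)) →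
      partPerim E K ≤ partPerim F K

/-- `E` is isoperimetric: `J`-isoperimetric in `ℝ^d` with `J` the finite-volume regions. -/
def IsIsoperimetric {d N : ℕ} (E : Fin N → Set (Euc d)) : Prop :=
  IsJIsoperimetric E univ {j | volume (E j) ≠ ⊤}

/-- `L¹_loc` convergence of a family of sets along a filter. -/
def SetTendstoL1loc {d : ℕ} {ι : Type*} (l : Filter ι) (A : ι → Set (Euc d))
    (A' : Set (Euc d)) : Prop :=
  ∀ B : Set (Euc d), MeasurableSet B → Bornology.IsBounded B →
    Tendsto (fun n => volume ((A n ∆ A') ∩ B)) l (𝓝 0)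

/-- `L¹_loc` convergence of partitions. -/
def PartTendstoL1loc {d N : ℕ} {ι : Type*} (l : Filter ι) (E : ι → Fin N → Set (Euc d))
    (F : Fin N → Set (Euc d)) : Prop :=
  ∀ j, SetTendstoL1loc l (fun n => E n j) (F j)

/-- The translate `E - x`. -/
def tr {d : ℕ} (E : Set (Euc d)) (x : Euc d) : Set (Euc d) := (fun y => y + x) ⁻¹' E

/-- The dilation `E / r`. -/
def dil {d : ℕ} (E : Set (Euc d)) (r : ℝ) : Set (Euc d) := (fun y => r • y) ⁻¹' E

/-- A (positively homogeneous) cone with vertex at the origin. -/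
def IsCone {d : ℕ} (C : Set (Euc d)) : Prop := ∀ t : ℝ, 0 < t → ∀ x ∈ C, t • x ∈ C

/-- The measure-theoretic representative of a set: its points of essential closure. -/
def essCl {d : ℕ} (E : Set (Euc d)) : Set (Euc d) :=
  {x | ∀ r > 0, 0 < volume (E ∩ ball x r)}

/-- The Euclidean norm of the first four coordinates of a point of `ℝ⁸ = ℝ⁴ × ℝ⁴`. -/
def nlo (x : Euc 8) : ℝ := Real.sqrt (∑ i : Fin 8, if (i : ℕ) < 4 then (x i) ^ 2 else 0)

/-- The Euclidean norm of the last four coordinates of a point of `ℝ⁸ = ℝ⁴ × ℝ⁴`. -/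
def nhi (x : Euc 8) : ℝ := Real.sqrt (∑ i : Fin 8, if (i : ℕ) < 4 then 0 else (x i) ^ 2)

/-- The Simons' cone partition `S = (∅, S₂, S₃)` of `ℝ⁸`. -/
def SimonsPart : Fin 3 → Set (Euc 8) :=
  ![(∅ : Set (Euc 8)), {x | nlo x ≤ nhi x}, {x | nhi x < nlo x}]

/-- The bounded region `Q₁ = 𝔹⁴ × 𝔹⁴` of the barrel partition. -/
def barrelRegion : Set (Euc 8) := {x | nlo x ≤ 1 ∧ nhi x ≤ 1}

/-- The barrel partition `Q = (Q₁, S₂ \ Q₁, S₃ \ Q₁)` of `ℝ⁸`. -/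
def barrelPart : Fin 3 → Set (Euc 8) :=
  ![barrelRegion, SimonsPart 1 \ barrelRegion, SimonsPart 2 \ barrelRegion]

/-- On open sets the outer regularization in the definition of the perimeter is superfluous. -/
lemma perim_of_isOpen {d : ℕ} (E : Set (Euc d)) {U : Set (Euc d)} (hU : IsOpen U) :
    perim E U = ⨆ (φ : Euc d → Euc d) (_ : ContDiff ℝ 1 φ) (_ : HasCompactSupport φ)
      (_ : tsupport φ ⊆ U) (_ : ∀ x, ‖φ x‖ ≤ 1), ENNReal.ofReal (∫ x in E, vdiv φ x) := by
  apply le_antisymm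
  · exact iInf_le_of_le U (iInf_le_of_le hU (iInf_le_of_le subset_rfl le_rfl))
  · refine le_iInf fun V => le_iInf fun _ => le_iInf fun hUV => ?_
    refine iSup_mono fun φ => iSup_mono fun _ => iSup_mono fun _ => ?_
    exact iSup_le fun h => le_iSup_of_le (h.trans hUV) le_rfl

lemma continuous_vdiv {d : ℕ} {φ : Euc d → Euc d} (hφ : ContDiff ℝ 1 φ) :
    Continuous (vdiv φ) := by
  have := hφ.continuous_fderiv one_ne_zero
  unfold vdiv
  fun_prop

lemma hasCompactSupport_vdiv {d : ℕ} {φ : Euc d → Euc d} (hc : HasCompactSupport φ) :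
    HasCompactSupport (vdiv φ) := by
  refine (hc.fderiv ℝ).mono fun x hx => ?_
  contrapose! hx
  simp only [Function.mem_support, not_not] at hx ⊢
  simp [vdiv, hx]

lemma integrable_vdiv {d : ℕ} {φ : Euc d → Euc d} (hφ : ContDiff ℝ 1 φ)
    (hc : HasCompactSupport φ) : Integrable (vdiv φ) :=
  (continuous_vdiv hφ).integrable_of_hasCompactSupport (hasCompactSupport_vdiv hc)

lemma norm_fderiv_le_of_lipschitz' {d : ℕ} {f : Euc d → ℝ} {C : NNReal} (hf : LipschitzWith C f)
    (x v : Euc d) : |fderiv ℝ f x v| ≤ C * ‖v‖ := by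
  refine ((fderiv ℝ f x).le_opNorm v).trans ?_
  gcongr
  exact norm_fderiv_le_of_lipschitz ℝ hf

/-- Integration by parts of a Lipschitz function against a compactly supported field. -/
lemma integral_mul_vdiv {d : ℕ} {f : Euc d → ℝ} {C : NNReal} (hf : LipschitzWith C f)
    {φ : Euc d → Euc d} (hφ : ContDiff ℝ 1 φ) (hc : HasCompactSupport φ) :
    Integrable (fun x => fderiv ℝ f x (φ x)) ∧
      ∫ x, f x * vdiv φ x = -∫ x, fderiv ℝ f x (φ x) := by
  have hcoord (i : Fin d) : ContDiff ℝ 1 fun x => φ x i := by fun_prop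
  have hccoord (i : Fin d) : HasCompactSupport fun x => φ x i :=
    hc.comp_left (g := fun v : Euc d => v i) rfl
  have hD (i : Fin d) (x : Euc d) :
      lineDeriv ℝ (fun x => φ x i) x (-EuclideanSpace.single i 1)
        = -fderiv ℝ φ x (EuclideanSpace.single i 1) i := by
    have h1 : DifferentiableAt ℝ φ x := hφ.differentiable one_ne_zero x
    have h2 : HasFDerivAt (fun x => φ x i)
        ((EuclideanSpace.proj i : Euc d →L[ℝ] ℝ).comp (fderiv ℝ φ x)) x :=
      (EuclideanSpace.proj i : Euc d →L[ℝ] ℝ).hasFDerivAt.comp x h1.hasFDerivAt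
    rw [(h2.hasLineDerivAt _).lineDeriv]
    simp
  have hIBP (i : Fin d) :
      ∫ x, lineDeriv ℝ f x (EuclideanSpace.single i 1) * φ x i
        = -∫ x, f x * fderiv ℝ φ x (EuclideanSpace.single i 1) i := by
    obtain ⟨D, hg⟩ := (hcoord i).lipschitzWith_of_hasCompactSupport (hccoord i) one_ne_zero
    rw [hf.integral_lineDeriv_mul_eq hg (hccoord i), ← integral_neg]
    refine integral_congr_ae (Eventually.of_forall fun x => ?_)
    simp only [hD]
    ring
  have hint1 (i : Fin d) :
      Integrable fun x => lineDeriv ℝ f x (EuclideanSpace.single i 1) * φ x i := by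
    have h1 : Integrable fun x => φ x i :=
      (hcoord i).continuous.integrable_of_hasCompactSupport (hccoord i)
    refine h1.bdd_mul (c := C * ‖(EuclideanSpace.single i 1 : Euc d)‖)
      (aestronglyMeasurable_lineDeriv hf.continuous _) ?_
    exact Eventually.of_forall fun x => norm_lineDeriv_le_of_lipschitz ℝ hf
  have hae : (fun x => fderiv ℝ f x (φ x)) =ᵐ[volume]
      fun x => ∑ i, lineDeriv ℝ f x (EuclideanSpace.single i 1) * φ x i := by
    filter_upwards [hf.ae_differentiableAt (μ := volume)] with x hx
    have h0 : φ x = ∑ i, φ x i • (EuclideanSpace.single i (1 : ℝ)) := by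
      ext j
      simp [Pi.single_apply]
    conv_lhs => rw [h0]
    simp only [map_sum, map_smul, smul_eq_mul]
    refine Finset.sum_congr rfl fun i _ => ?_
    rw [hx.lineDeriv_eq_fderiv, mul_comm]
  refine ⟨(integrable_finsetSum _ fun i _ => hint1 i).congr hae.symm, ?_⟩
  have hint2 (i : Fin d) :
      Integrable fun x => f x * fderiv ℝ φ x (EuclideanSpace.single i 1) i := by
    have hcont : Continuous fun x => fderiv ℝ φ x (EuclideanSpace.single i 1) i := by
      have := hφ.continuous_fderiv one_ne_zero
      fun_prop
    refine (hf.continuous.mul hcont).integrable_of_hasCompactSupport ?_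
    refine HasCompactSupport.mul_left ?_
    refine (hc.fderiv ℝ).mono fun x hx => ?_
    contrapose! hx
    simp only [Function.mem_support, not_not] at hx ⊢
    simp [hx]
  rw [integral_congr_ae hae, integral_finsetSum _ fun i _ => hint1 i]
  simp only [hIBP, vdiv, Finset.mul_sum]
  rw [integral_finsetSum _ fun i _ => hint2 i]
  simp

/-- The Lipschitz approximation of the indicator of `{g ≤ 0}` that is affine in `g` on the layer
`{0 < g < ε}`. -/
def ramp {d : ℕ} (g : Euc d → ℝ) (ε : ℝ) (x : Euc d) : ℝ := max 0 (min 1 (1 - g x / ε))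

/-- The layer of width `ε` outside `{g ≤ 0}`. -/
def layer {d : ℕ} (g : Euc d → ℝ) (ε : ℝ) : Set (Euc d) := {x | 0 < g x ∧ g x < ε}

section Ramp

variable {d : ℕ} {g : Euc d → ℝ} {ε : ℝ}

lemma ramp_nonneg (x : Euc d) : 0 ≤ ramp g ε x := le_max_left _ _

lemma ramp_le_one (x : Euc d) : ramp g ε x ≤ 1 := max_le zero_le_one (min_le_left _ _)

lemma ramp_of_nonpos (hε : 0 < ε) {x : Euc d} (hx : g x ≤ 0) : ramp g ε x = 1 := by
  have : g x / ε ≤ 0 := div_nonpos_of_nonpos_of_nonneg hx hε.le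
  rw [ramp, min_eq_left (by linarith), max_eq_right zero_le_one]

lemma ramp_of_le (hε : 0 < ε) {x : Euc d} (hx : ε ≤ g x) : ramp g ε x = 0 := by
  have : 1 ≤ g x / ε := (one_le_div hε).2 hx
  rw [ramp, max_eq_left ((min_le_right _ _).trans (by linarith))]

lemma ramp_of_mem_layer {x : Euc d} (hx : x ∈ layer g ε) : ramp g ε x = 1 - g x / ε := by
  have hε : 0 < ε := hx.1.trans hx.2
  have h1 : g x / ε < 1 := (div_lt_one hε).2 hx.2
  have h2 : 0 < g x / ε := div_pos hx.1 hε
  rw [ramp, min_eq_right (by linarith), max_eq_right (by linarith)]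

lemma isOpen_layer (hg : Continuous g) : IsOpen (layer g ε) :=
  (isOpen_lt continuous_const hg).inter (isOpen_lt hg continuous_const)

lemma lipschitzWith_ramp (hg : LipschitzWith 1 g) (hε : 0 < ε) :
    LipschitzWith (Real.toNNReal (1 / ε)) (ramp g ε) := by
  have h : LipschitzWith (Real.toNNReal (1 / ε)) fun x => 1 - g x / ε := by
    refine LipschitzWith.of_dist_le_mul fun x y => ?_
    have := hg.dist_le_mul x y
    rw [Real.coe_toNNReal _ (by positivity), Real.dist_eq]
    rw [Real.dist_eq, NNReal.coe_one, one_mul] at this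
    rw [show 1 - g x / ε - (1 - g y / ε) = -((1 / ε) * (g x - g y)) by ring, abs_neg, abs_mul,
      abs_of_pos (by positivity)]
    gcongr
  exact (h.const_min 1).const_max 0

lemma fderiv_ramp_of_notMem_layer (hε : 0 < ε) {x : Euc d} (hx : x ∉ layer g ε) :
    fderiv ℝ (ramp g ε) x = 0 := by
  rcases le_or_gt (g x) 0 with h | h
  · refine IsLocalMax.fderiv_eq_zero (Eventually.of_forall fun y => ?_)
    rw [ramp_of_nonpos hε h]
    exact ramp_le_one y
  · refine IsLocalMin.fderiv_eq_zero (Eventually.of_forall fun y => ?_)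
    rw [ramp_of_le hε (not_lt.1 fun h' => hx ⟨h, h'⟩)]
    exact ramp_nonneg y

lemma fderiv_ramp_of_mem_layer (hg : Continuous g) {x v : Euc d} (hx : x ∈ layer g ε)
    (hd : DifferentiableAt ℝ g x) (hv : HasLineDerivAt ℝ g 1 x v) :
    fderiv ℝ (ramp g ε) x v = -(1 / ε) := by
  have h1 : ramp g ε =ᶠ[𝓝 x] fun y => 1 - g y / ε := by
    filter_upwards [(isOpen_layer hg).mem_nhds hx] with y hy using ramp_of_mem_layer hy
  have h2 : HasFDerivAt (fun y => 1 - g y / ε) (-(ε⁻¹ • fderiv ℝ g x)) x := by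
    have := (hd.hasFDerivAt.const_smul ε⁻¹).const_sub 1
    refine this.congr_of_eventuallyEq (Eventually.of_forall fun y => ?_)
    simp [div_eq_inv_mul]
  have h3 : fderiv ℝ g x v = 1 := by
    rw [← hd.lineDeriv_eq_fderiv, hv.lineDeriv]
  rw [h1.fderiv_eq, h2.fderiv]
  simp [h3]

lemma abs_fderiv_ramp_le (hg : LipschitzWith 1 g) (hε : 0 < ε) {x v : Euc d} (hv : ‖v‖ ≤ 1) :
    |fderiv ℝ (ramp g ε) x v| ≤ 1 / ε := by
  refine (norm_fderiv_le_of_lipschitz' (lipschitzWith_ramp hg hε) x v).trans ?_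
  rw [Real.coe_toNNReal _ (by positivity)]
  exact mul_le_of_le_one_right (by positivity) hv

lemma tendsto_integral_ramp (hg : Continuous g) {h : Euc d → ℝ} (hh : Integrable h) :
    Tendsto (fun ε => ∫ x, ramp g ε x * h x) (𝓝[>] 0) (𝓝 (∫ x in {x | g x ≤ 0}, h x)) := by
  have hm : MeasurableSet {x | g x ≤ 0} := (isClosed_le hg continuous_const).measurableSet
  rw [← integral_indicator hm]
  refine tendsto_integral_filter_of_dominated_convergence (fun x => ‖h x‖) ?_ ?_ hh.norm ?_
  · refine Eventually.of_forall fun ε => ?_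
    have : Continuous (ramp g ε) := by unfold ramp; fun_prop
    exact this.aestronglyMeasurable.mul hh.aestronglyMeasurable
  · refine Eventually.of_forall fun ε => Eventually.of_forall fun x => ?_
    rw [norm_mul, Real.norm_of_nonneg (ramp_nonneg x)]
    exact mul_le_of_le_one_left (norm_nonneg _) (ramp_le_one x)
  · refine Eventually.of_forall fun x => ?_
    refine tendsto_const_nhds.congr' ?_
    by_cases hx : g x ≤ 0
    · filter_upwards [self_mem_nhdsWithin] with ε hε
      rw [ramp_of_nonpos hε hx, one_mul, indicator_of_mem (by exact hx)]
    · filter_upwards [Ioo_mem_nhdsGT (not_le.1 hx)] with ε hε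
      rw [ramp_of_le hε.1 hε.2.le, zero_mul, indicator_of_notMem (by exact hx)]

end Ramp

/-- The perimeter of a sublevel set of a `1`-Lipschitz function equals the outer Minkowski content
of its boundary, provided the latter exists and unit fields that are aligned with the gradient on
most of the layers are available. -/
theorem perim_eq_of_tendsto_layer {d : ℕ} {g : Euc d → ℝ} (hg : LipschitzWith 1 g)
    {U : Set (Euc d)} (hU : IsOpen U) (hUfin : volume U ≠ ⊤) {L : ℝ}
    (hV : Tendsto (fun ε => volume.real (U ∩ layer g ε) / ε) (𝓝[>] 0) (𝓝 L))
    (hfield : ∀ κ > 0, ∃ φ : Euc d → Euc d, ContDiff ℝ 1 φ ∧ HasCompactSupport φ ∧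
      tsupport φ ⊆ U ∧ (∀ x, ‖φ x‖ ≤ 1) ∧ ∃ G : Set (Euc d), MeasurableSet G ∧
        (∀ x ∈ G, 0 < g x → HasLineDerivAt ℝ g 1 x (φ x)) ∧
        ∀ᶠ ε in 𝓝[>] 0, volume.real ((U ∩ layer g ε) \ G) ≤ κ * ε) :
    perim {x | g x ≤ 0} U = ENNReal.ofReal L := by
  have hgc := hg.continuous
  have hlim {φ : Euc d → Euc d} (h1 : ContDiff ℝ 1 φ) (h2 : HasCompactSupport φ) :
      Tendsto (fun ε => -∫ x, fderiv ℝ (ramp g ε) x (φ x)) (𝓝[>] 0)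
        (𝓝 (∫ x in {x | g x ≤ 0}, vdiv φ x)) := by
    refine (tendsto_integral_ramp hgc (integrable_vdiv h1 h2)).congr' ?_
    filter_upwards [self_mem_nhdsWithin] with ε hε
    exact (integral_mul_vdiv (lipschitzWith_ramp hg hε) h1 h2).2
  have hmeas (ε : ℝ) : MeasurableSet (U ∩ layer g ε) :=
    (hU.inter (isOpen_layer hgc)).measurableSet
  have hfin (ε : ℝ) : volume (U ∩ layer g ε) ≠ ⊤ := measure_ne_top_of_subset inter_subset_left hUfin
  have hzero {φ : Euc d → Euc d} (h3 : tsupport φ ⊆ U) {ε : ℝ} (hε : 0 < ε) {x : Euc d}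
      (hx : x ∉ U ∩ layer g ε) : fderiv ℝ (ramp g ε) x (φ x) = 0 := by
    by_cases hxU : x ∈ U
    · rw [fderiv_ramp_of_notMem_layer hε fun h => hx ⟨hxU, h⟩]
      simp
    · rw [image_eq_zero_of_notMem_tsupport fun h => hxU (h3 h), map_zero]
  have hind (ε c : ℝ) {A : Set (Euc d)} (hA : MeasurableSet A) (hAU : A ⊆ U ∩ layer g ε) :
      Integrable (A.indicator fun _ => c) ∧ ∫ x, A.indicator (fun _ => c) x
        = volume.real A * c := by
    constructor
    · exact (integrable_indicator_iff hA).2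
        (integrableOn_const (measure_ne_top_of_subset hAU (hfin ε)))
    · rw [integral_indicator hA, setIntegral_const, smul_eq_mul]
  rw [perim_of_isOpen _ hU]
  apply le_antisymm
  · refine iSup_le fun φ => iSup_le fun h1 => iSup_le fun h2 => iSup_le fun h3 => iSup_le fun h4 =>
      ENNReal.ofReal_le_ofReal ?_
    refine le_of_tendsto_of_tendsto (hlim h1 h2) hV ?_
    filter_upwards [self_mem_nhdsWithin] with ε (hε : 0 < ε)
    obtain ⟨hi, hi'⟩ := hind ε (1 / ε) (hmeas ε) subset_rfl
    rw [div_eq_mul_one_div, ← hi', ← integral_neg]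
    refine integral_mono (integral_mul_vdiv (lipschitzWith_ramp hg hε) h1 h2).1.neg hi fun x => ?_
    by_cases hx : x ∈ U ∩ layer g ε
    · simp only [Set.indicator_of_mem hx]
      exact (neg_le_abs _).trans (abs_fderiv_ramp_le hg hε (h4 x))
    · simp only [Set.indicator_of_notMem hx, hzero h3 hε hx, neg_zero, le_refl]
  · refine ENNReal.le_of_forall_pos_le_add fun κ hκ _ => ?_
    obtain ⟨φ, h1, h2, h3, h4, G, hG, hGφ, hGε⟩ := hfield (κ / 2) (by positivity)
    have hle : L - κ ≤ ∫ x in {x | g x ≤ 0}, vdiv φ x := by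
      refine le_of_tendsto_of_tendsto (hV.sub_const _) (hlim h1 h2) ?_
      filter_upwards [self_mem_nhdsWithin, hGε] with ε (hε : 0 < ε) hbad
      obtain ⟨hi, hi'⟩ := hind ε (1 / ε) (hmeas ε) subset_rfl
      obtain ⟨hj, hj'⟩ := hind ε (2 / ε) ((hmeas ε).diff hG) sdiff_subset
      have hbad' : volume.real ((U ∩ layer g ε) \ G) * (2 / ε) ≤ κ := by
        calc _ ≤ κ / 2 * ε * (2 / ε) := by gcongr
          _ = κ := by field_simp
      refine le_trans (b := volume.real (U ∩ layer g ε) * (1 / ε) -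
        volume.real ((U ∩ layer g ε) \ G) * (2 / ε)) ?_ ?_
      · rw [div_eq_mul_one_div]
        linarith
      rw [← hi', ← hj', ← integral_sub hi hj, ← integral_neg]
      refine integral_mono_ae (hi.sub hj)
        (integral_mul_vdiv (lipschitzWith_ramp hg hε) h1 h2).1.neg ?_
      filter_upwards [hg.ae_differentiableAt (μ := volume)] with x hd
      by_cases hx : x ∈ U ∩ layer g ε
      · by_cases hxG : x ∈ G
        · simp only [Set.indicator_of_mem hx, Set.indicator_of_notMem (fun h => h.2 hxG :
            x ∉ (U ∩ layer g ε) \ G)]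
          rw [fderiv_ramp_of_mem_layer hgc hx.2 hd (hGφ x hxG hx.2.1)]
          simp
        · have hm : x ∈ (U ∩ layer g ε) \ G := ⟨hx, hxG⟩
          simp only [Set.indicator_of_mem hx, Set.indicator_of_mem hm]
          have := (le_abs_self _).trans (abs_fderiv_ramp_le hg hε (h4 x) (x := x))
          rw [show 1 / ε - 2 / ε = -(1 / ε) by ring]
          exact neg_le_neg this
      · simp only [Set.indicator_of_notMem hx, Set.indicator_of_notMem (fun h => hx h.1 :
            x ∉ (U ∩ layer g ε) \ G), hzero h3 hε hx, neg_zero, sub_zero, le_refl]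
    calc ENNReal.ofReal L = ENNReal.ofReal (L - κ + κ) := by ring_nf
      _ ≤ ENNReal.ofReal (L - κ) + ENNReal.ofReal κ := ENNReal.ofReal_add_le
      _ ≤ _ := by
        rw [ENNReal.ofReal_coe_nnreal]
        gcongr
        refine (ENNReal.ofReal_le_ofReal hle).trans ?_
        exact le_iSup_of_le φ (le_iSup_of_le h1 (le_iSup_of_le h2 (le_iSup_of_le h3
          (le_iSup_of_le h4 le_rfl))))

/-- The perimeter only depends on the set up to null sets. -/
lemma perim_congr_ae {d : ℕ} {E F : Set (Euc d)} (h : E =ᵐ[volume] F) (B : Set (Euc d)) :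
    perim E B = perim F B := by
  simp only [perim, setIntegral_congr_set h]

/-- The projection of `ℝ⁸ = ℝ⁴ × ℝ⁴` onto the first factor. -/
def lo : Euc 8 →L[ℝ] Euc 8 := LinearMap.toContinuousLinearMap
  { toFun := fun x => WithLp.toLp 2 fun i : Fin 8 => if (i : ℕ) < 4 then x i else 0
    map_add' := fun x y => by
      ext i
      by_cases h : (i : ℕ) < 4 <;> simp [h]
    map_smul' := fun c x => by
      ext i
      by_cases h : (i : ℕ) < 4 <;> simp [h] }

/-- The projection of `ℝ⁸ = ℝ⁴ × ℝ⁴` onto the second factor. -/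
def hi : Euc 8 →L[ℝ] Euc 8 := ContinuousLinearMap.id ℝ (Euc 8) - lo

lemma lo_apply (x : Euc 8) (i : Fin 8) : lo x i = if (i : ℕ) < 4 then x i else 0 := rfl

lemma hi_apply (x : Euc 8) (i : Fin 8) : hi x i = if (i : ℕ) < 4 then 0 else x i := by
  by_cases h : (i : ℕ) < 4 <;> simp [hi, lo_apply, h]

lemma nlo_eq_norm (x : Euc 8) : nlo x = ‖lo x‖ := by
  rw [EuclideanSpace.norm_eq, nlo]
  congr 1
  refine Finset.sum_congr rfl fun i _ => ?_
  by_cases h : (i : ℕ) < 4 <;> simp [lo_apply, h]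

lemma nhi_eq_norm (x : Euc 8) : nhi x = ‖hi x‖ := by
  rw [EuclideanSpace.norm_eq, nhi]
  congr 1
  refine Finset.sum_congr rfl fun i _ => ?_
  by_cases h : (i : ℕ) < 4 <;> simp [hi_apply, h]

lemma lo_lo (x : Euc 8) : lo (lo x) = lo x := by
  ext i
  by_cases h : (i : ℕ) < 4 <;> simp [lo_apply, h]

lemma lo_hi (x : Euc 8) : lo (hi x) = 0 := by
  ext i
  by_cases h : (i : ℕ) < 4 <;> simp [lo_apply, hi_apply, h]

lemma hi_lo (x : Euc 8) : hi (lo x) = 0 := by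
  ext i
  by_cases h : (i : ℕ) < 4 <;> simp [lo_apply, hi_apply, h]

lemma hi_hi (x : Euc 8) : hi (hi x) = hi x := by
  ext i
  by_cases h : (i : ℕ) < 4 <;> simp [hi_apply, h]

lemma norm_sq_eq (x : Euc 8) : ‖x‖ ^ 2 = ‖lo x‖ ^ 2 + ‖hi x‖ ^ 2 := by
  simp only [EuclideanSpace.norm_sq_eq, ← Finset.sum_add_distrib]
  refine Finset.sum_congr rfl fun i _ => ?_
  by_cases h : (i : ℕ) < 4 <;> simp [lo_apply, hi_apply, h]

/-- The pair of norms of the two components of a point of `ℝ⁸ = ℝ⁴ × ℝ⁴`. -/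
def biNorm (x : Euc 8) : ℝ × ℝ := (nlo x, nhi x)

lemma biNorm_eq (x : Euc 8) : biNorm x = (‖lo x‖, ‖hi x‖) := by
  rw [biNorm, nlo_eq_norm, nhi_eq_norm]

lemma continuous_biNorm : Continuous biNorm := by
  simp only [funext biNorm_eq]
  fun_prop

/-- The distribution of `biNorm` under Lebesgue measure. -/
def biRad : Measure (ℝ × ℝ) := (volume : Measure (Euc 8)).map biNorm

lemma biRad_real_apply {A : Set (ℝ × ℝ)} (hA : MeasurableSet A) :
    biRad.real A = volume.real (biNorm ⁻¹' A) :=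
  map_measureReal_apply continuous_biNorm.measurable hA

/-- The affine function `a s + b t - c` on the plane. -/
def aff (a b c : ℝ) (p : ℝ × ℝ) : ℝ := a * p.1 + b * p.2 - c

lemma continuous_aff {a b c : ℝ} : Continuous (aff a b c) := by
  unfold aff
  fun_prop

lemma contDiff_aff {a b c : ℝ} : ContDiff ℝ 1 (aff a b c) := by
  unfold aff
  fun_prop

lemma lipschitzWith_aff_biNorm {a b : ℝ} (c : ℝ) (h : a ^ 2 + b ^ 2 = 1) :
    LipschitzWith 1 fun x => aff a b c (biNorm x) := by
  refine LipschitzWith.of_dist_le_mul fun x y => ?_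
  rw [NNReal.coe_one, one_mul, Real.dist_eq, dist_eq_norm]
  refine abs_le_of_sq_le_sq ?_ (norm_nonneg _)
  have h1 := abs_le.1 (abs_norm_sub_norm_le (lo x) (lo y))
  have h2 := abs_le.1 (abs_norm_sub_norm_le (hi x) (hi y))
  rw [norm_sq_eq (x - y), map_sub, map_sub]
  simp only [biNorm_eq, aff]
  generalize ‖lo x‖ = s at *
  generalize ‖lo y‖ = s' at *
  generalize ‖hi x‖ = t at *
  generalize ‖hi y‖ = t' at *
  have h3 : (s - s') ^ 2 ≤ ‖lo x - lo y‖ ^ 2 := sq_le_sq' h1.1 h1.2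
  have h4 : (t - t') ^ 2 ≤ ‖hi x - hi y‖ ^ 2 := sq_le_sq' h2.1 h2.2
  have h5 : (a * (s - s') + b * (t - t')) ^ 2 ≤
      (a ^ 2 + b ^ 2) * ((s - s') ^ 2 + (t - t') ^ 2) := by
    nlinarith [sq_nonneg (a * (t - t') - b * (s - s'))]
  rw [h, one_mul] at h5
  nlinarith

lemma lipschitzWith_max_aff_biNorm {a₁ b₁ a₂ b₂ : ℝ} (c₁ c₂ : ℝ) (h₁ : a₁ ^ 2 + b₁ ^ 2 = 1)
    (h₂ : a₂ ^ 2 + b₂ ^ 2 = 1) :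
    LipschitzWith 1 fun x => max (aff a₁ b₁ c₁ (biNorm x)) (aff a₂ b₂ c₂ (biNorm x)) := by
  simpa using (lipschitzWith_aff_biNorm c₁ h₁).max (lipschitzWith_aff_biNorm c₂ h₂)

/-- The biradial vector field on `ℝ⁸` with radial components `A` and `B`. -/
def biField (A B : ℝ × ℝ → ℝ) (x : Euc 8) : Euc 8 :=
  (A (biNorm x) / ‖lo x‖) • lo x + (B (biNorm x) / ‖hi x‖) • hi x

section Field

variable {A B : ℝ × ℝ → ℝ}

lemma norm_biField_le (h : ∀ p, A p ^ 2 + B p ^ 2 ≤ 1) (x : Euc 8) : ‖biField A B x‖ ≤ 1 := by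
  have h1 : ‖biField A B x‖ ^ 2 ≤ 1 := by
    have key (c : ℝ) (v : Euc 8) : ‖(c / ‖v‖) • v‖ ^ 2 ≤ c ^ 2 := by
      rcases eq_or_ne v 0 with rfl | hv
      · simp [sq_nonneg]
      · rw [norm_smul, norm_div, norm_norm, div_mul_cancel₀ _ (norm_ne_zero_iff.2 hv),
          Real.norm_eq_abs, sq_abs]
    rw [norm_sq_eq, biField]
    simp only [map_add, map_smul, lo_lo, lo_hi, hi_lo, hi_hi, smul_zero, add_zero, zero_add]
    exact (add_le_add (key _ _) (key _ _)).trans (h _)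
  exact (sq_le_one_iff₀ (norm_nonneg _)).1 h1

lemma contDiff_biField (hA : ContDiff ℝ 1 A) (hB : ContDiff ℝ 1 B) {δ : ℝ} (hδ : 0 < δ)
    (h0 : ∀ p : ℝ × ℝ, p.1 < δ ∨ p.2 < δ → A p = 0 ∧ B p = 0) :
    ContDiff ℝ 1 (biField A B) := by
  refine contDiff_iff_contDiffAt.2 fun x => ?_
  by_cases hx : (biNorm x).1 < δ ∨ (biNorm x).2 < δ
  · have hopen : IsOpen {p : ℝ × ℝ | p.1 < δ ∨ p.2 < δ} :=
      (isOpen_lt continuous_fst continuous_const).union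
        (isOpen_lt continuous_snd continuous_const)
    have : biField A B =ᶠ[𝓝 x] fun _ => 0 := by
      filter_upwards [continuous_biNorm.continuousAt.preimage_mem_nhds (hopen.mem_nhds hx)]
        with y hy
      simp [biField, h0 _ hy]
    exact contDiffAt_const.congr_of_eventuallyEq this
  · push Not at hx
    rw [biNorm_eq] at hx
    have h1 : lo x ≠ 0 := norm_pos_iff.1 (hδ.trans_le hx.1)
    have h2 : hi x ≠ 0 := norm_pos_iff.1 (hδ.trans_le hx.2)
    have h3 : ContDiffAt ℝ 1 (fun y => ‖lo y‖) x := lo.contDiff.contDiffAt.norm ℝ h1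
    have h4 : ContDiffAt ℝ 1 (fun y => ‖hi y‖) x := hi.contDiff.contDiffAt.norm ℝ h2
    have h5 : ContDiffAt ℝ 1 biNorm x := by
      simp only [funext biNorm_eq]
      exact h3.prodMk h4
    have h6 : ContDiffAt ℝ 1 (fun y => A (biNorm y)) x := hA.contDiffAt.comp x h5
    have h7 : ContDiffAt ℝ 1 (fun y => B (biNorm y)) x := hB.contDiffAt.comp x h5
    exact ((h6.div h3 (norm_ne_zero_iff.2 h1)).smul lo.contDiff.contDiffAt).add
      ((h7.div h4 (norm_ne_zero_iff.2 h2)).smul hi.contDiff.contDiffAt)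

lemma mem_ball_iff_biNorm {r : ℝ} (hr : 0 ≤ r) (x : Euc 8) :
    x ∈ ball (0 : Euc 8) r ↔ (biNorm x).1 ^ 2 + (biNorm x).2 ^ 2 < r ^ 2 := by
  rw [mem_ball_zero_iff, biNorm_eq, ← norm_sq_eq, sq_lt_sq₀ (norm_nonneg _) hr]

lemma tsupport_biField_subset {ρ : ℝ} (hρ : 0 ≤ ρ)
    (h0 : ∀ p : ℝ × ℝ, ρ ^ 2 ≤ p.1 ^ 2 + p.2 ^ 2 → A p = 0 ∧ B p = 0) :
    tsupport (biField A B) ⊆ closedBall 0 ρ := by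
  refine closure_minimal (fun x hx => ?_) isClosed_closedBall
  by_contra hxρ
  have : ρ ^ 2 ≤ (biNorm x).1 ^ 2 + (biNorm x).2 ^ 2 := by
    rw [← not_lt, ← mem_ball_iff_biNorm hρ]
    exact fun h => hxρ (ball_subset_closedBall h)
  exact hx (by simp [biField, h0 _ this])

lemma eventually_biNorm_add_smul_biField {x : Euc 8} (h1 : 0 < (biNorm x).1)
    (h2 : 0 < (biNorm x).2) :
    ∀ᶠ τ : ℝ in 𝓝 0, biNorm (x + τ • biField A B x)
      = ((biNorm x).1 + τ * A (biNorm x), (biNorm x).2 + τ * B (biNorm x)) := by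
  have key {v : Euc 8} (hv : 0 < ‖v‖) (c : ℝ) :
      ∀ᶠ τ : ℝ in 𝓝 0, ‖v + τ • (c / ‖v‖) • v‖ = ‖v‖ + τ * c := by
    have : Tendsto (fun τ : ℝ => 1 + τ * (c / ‖v‖)) (𝓝 0) (𝓝 1) := by
      have : Continuous fun τ : ℝ => 1 + τ * (c / ‖v‖) := by fun_prop
      simpa using this.tendsto 0
    filter_upwards [this.eventually (lt_mem_nhds zero_lt_one)] with τ hτ
    have : v + τ • (c / ‖v‖) • v = (1 + τ * (c / ‖v‖)) • v := by
      rw [add_smul, one_smul, mul_smul]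
    rw [this, norm_smul, Real.norm_of_nonneg hτ.le]
    field_simp
  simp only [biNorm_eq] at h1 h2
  filter_upwards [key h1 (A (biNorm x)), key h2 (B (biNorm x))] with τ e1 e2
  rw [biNorm_eq (x + _), show (biNorm x).1 = ‖lo x‖ from nlo_eq_norm x,
    show (biNorm x).2 = ‖hi x‖ from nhi_eq_norm x, ← e1, ← e2]
  simp [biField, lo_lo, lo_hi, hi_lo, hi_hi]

end Field

/-- A smooth cutoff equal to one on the part of the quadrant at distance `δ` from its sides and
from the circle of radius `r`, and supported away from these. -/
def quadCutoff (r δ : ℝ) (p : ℝ × ℝ) : ℝ :=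
  Real.smoothTransition (2 * p.1 / δ - 1) * Real.smoothTransition (2 * p.2 / δ - 1) *
    Real.smoothTransition (((r - δ / 2) ^ 2 - (p.1 ^ 2 + p.2 ^ 2)) /
      ((r - δ / 2) ^ 2 - (r - δ) ^ 2))

lemma contDiff_quadCutoff {r δ : ℝ} : ContDiff ℝ 1 (quadCutoff r δ) := by
  have h : ContDiff ℝ 1 Real.smoothTransition := Real.smoothTransition.contDiff
  unfold quadCutoff
  refine ((h.comp ?_).mul (h.comp ?_)).mul (h.comp ?_) <;> fun_prop

lemma quadCutoff_nonneg {r δ : ℝ} {p : ℝ × ℝ} : 0 ≤ quadCutoff r δ p :=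
  mul_nonneg (mul_nonneg (Real.smoothTransition.nonneg _) (Real.smoothTransition.nonneg _))
    (Real.smoothTransition.nonneg _)

lemma quadCutoff_le_one {r δ : ℝ} {p : ℝ × ℝ} : quadCutoff r δ p ≤ 1 :=
  mul_le_one₀ (mul_le_one₀ (Real.smoothTransition.le_one _) (Real.smoothTransition.nonneg _)
    (Real.smoothTransition.le_one _)) (Real.smoothTransition.nonneg _)
    (Real.smoothTransition.le_one _)

lemma quadCutoff_eq_zero_of_lt {r δ : ℝ} (hδ : 0 < δ) {p : ℝ × ℝ}
    (hp : p.1 < δ / 2 ∨ p.2 < δ / 2) : quadCutoff r δ p = 0 := by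
  have key {s : ℝ} (hs : s < δ / 2) : Real.smoothTransition (2 * s / δ - 1) = 0 := by
    refine Real.smoothTransition.zero_of_nonpos (sub_nonpos.2 ((div_le_one hδ).2 ?_))
    linarith
  rcases hp with h | h <;> simp [quadCutoff, key h]

lemma quadCutoff_eq_zero_of_le {r δ : ℝ} (hδ : 0 < δ) (hr : δ < r) {p : ℝ × ℝ}
    (hp : (r - δ / 2) ^ 2 ≤ p.1 ^ 2 + p.2 ^ 2) : quadCutoff r δ p = 0 := by
  have : 0 < (r - δ / 2) ^ 2 - (r - δ) ^ 2 := by nlinarith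
  rw [quadCutoff, Real.smoothTransition.zero_of_nonpos
    (div_nonpos_of_nonpos_of_nonneg (sub_nonpos.2 hp) this.le), mul_zero]

lemma quadCutoff_eq_one {r δ : ℝ} (hδ : 0 < δ) (hr : δ < r) {p : ℝ × ℝ} (h1 : δ < p.1)
    (h2 : δ < p.2) (h3 : p.1 ^ 2 + p.2 ^ 2 < (r - δ) ^ 2) : quadCutoff r δ p = 1 := by
  have key {s : ℝ} (hs : δ < s) : Real.smoothTransition (2 * s / δ - 1) = 1 := by
    refine Real.smoothTransition.one_of_one_le (le_sub_iff_add_le.2 ((le_div_iff₀ hδ).2 ?_))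
    linarith
  have : 0 < (r - δ / 2) ^ 2 - (r - δ) ^ 2 := by nlinarith
  rw [quadCutoff, key h1, key h2,
    Real.smoothTransition.one_of_one_le ((one_le_div this).2 (by linarith))]
  norm_num

/-- Switches between `a` and `a'` according to the sign of `u`, with a gap of width `2 δ`. -/
def switch (δ a a' u : ℝ) : ℝ :=
  Real.smoothTransition (u / δ) * a + Real.smoothTransition (-u / δ) * a'

lemma switch_of_lt {δ a a' u : ℝ} (hδ : 0 < δ) (hu : δ < u) : switch δ a a' u = a := by
  rw [switch, Real.smoothTransition.one_of_one_le ((one_le_div hδ).2 hu.le),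
    Real.smoothTransition.zero_of_nonpos (div_nonpos_of_nonpos_of_nonneg (by linarith) hδ.le)]
  ring

lemma switch_of_lt_neg {δ a a' u : ℝ} (hδ : 0 < δ) (hu : u < -δ) : switch δ a a' u = a' := by
  rw [switch, Real.smoothTransition.one_of_one_le (x := -u / δ)
    ((one_le_div hδ).2 (by linarith)),
    Real.smoothTransition.zero_of_nonpos (div_nonpos_of_nonpos_of_nonneg (by linarith) hδ.le)]
  ring

lemma sq_switch_add_sq_switch_le {δ a b a' b' u : ℝ} (hδ : 0 < δ) (h : a ^ 2 + b ^ 2 = 1)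
    (h' : a' ^ 2 + b' ^ 2 = 1) : switch δ a a' u ^ 2 + switch δ b b' u ^ 2 ≤ 1 := by
  have key (v : ℝ) : Real.smoothTransition v ^ 2 ≤ 1 :=
    pow_le_one₀ (Real.smoothTransition.nonneg _) (Real.smoothTransition.le_one _)
  rcases le_total u 0 with hu | hu
  · simp only [switch, Real.smoothTransition.zero_of_nonpos
      (div_nonpos_of_nonpos_of_nonneg hu hδ.le), zero_mul, zero_add, mul_pow, ← mul_add, h',
      mul_one, key]
  · simp only [switch, Real.smoothTransition.zero_of_nonpos
      (div_nonpos_of_nonpos_of_nonneg (neg_nonpos.2 hu) hδ.le), zero_mul, add_zero, mul_pow,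
      ← mul_add, h, mul_one, key]

lemma contDiff_switch {δ a a' : ℝ} : ContDiff ℝ 1 (switch δ a a') := by
  have h : ContDiff ℝ 1 Real.smoothTransition := Real.smoothTransition.contDiff
  unfold switch
  refine ((h.comp ?_).mul contDiff_const).add ((h.comp ?_).mul contDiff_const) <;> fun_prop

/-- The layer outside the sublevel set `{γ ≤ 0}` of a function of the two radii, in the disc of
radius `r`. -/
def planarLayer (γ : ℝ × ℝ → ℝ) (r ε : ℝ) : Set (ℝ × ℝ) :=
  {p | p.1 ^ 2 + p.2 ^ 2 < r ^ 2 ∧ 0 < γ p ∧ γ p < ε}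

/-- The points which are `δ`-close to the axes, to the circle of radius `r` or to the set where the
two given functions agree. -/
def badSet (ℓ₁ ℓ₂ : ℝ × ℝ → ℝ) (r δ : ℝ) : Set (ℝ × ℝ) :=
  {p | p.1 ≤ δ ∨ p.2 ≤ δ ∨ (r - δ) ^ 2 ≤ p.1 ^ 2 + p.2 ^ 2 ∨ |ℓ₁ p - ℓ₂ p| ≤ δ}

lemma measurableSet_planarLayer {γ : ℝ × ℝ → ℝ} (hγ : Continuous γ) (r ε : ℝ) :
    MeasurableSet (planarLayer γ r ε) := by
  have := hγ.measurable
  unfold planarLayer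
  measurability

lemma measurableSet_badSet {ℓ₁ ℓ₂ : ℝ × ℝ → ℝ} (h₁ : Continuous ℓ₁) (h₂ : Continuous ℓ₂)
    (r δ : ℝ) : MeasurableSet (badSet ℓ₁ ℓ₂ r δ) := by
  refine IsClosed.measurableSet ?_
  exact (isClosed_le continuous_fst continuous_const).union
    ((isClosed_le continuous_snd continuous_const).union
    ((isClosed_le continuous_const ((continuous_fst.pow 2).add (continuous_snd.pow 2))).union
    (isClosed_le (h₁.sub h₂).abs continuous_const)))

lemma hasLineDerivAt_of_eventuallyEq_aff {g : Euc 8 → ℝ} {γ A B : ℝ × ℝ → ℝ} {a b c : ℝ}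
    {x : Euc 8} (hg : ∀ y, g y = γ (biNorm y)) (h1 : 0 < (biNorm x).1) (h2 : 0 < (biNorm x).2)
    (hA : A (biNorm x) = a) (hB : B (biNorm x) = b) (hab : a ^ 2 + b ^ 2 = 1)
    (hγ : γ =ᶠ[𝓝 (biNorm x)] aff a b c) :
    HasLineDerivAt ℝ g 1 x (biField A B x) := by
  have hd : HasDerivAt (fun τ : ℝ => aff a b c (biNorm x) + τ) 1 0 :=
    (hasDerivAt_id (0 : ℝ)).const_add _
  refine hd.congr_of_eventuallyEq ?_
  have ht : Tendsto (fun τ : ℝ => x + τ • biField A B x) (𝓝 0) (𝓝 x) := by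
    have : Continuous fun τ : ℝ => x + τ • biField A B x := by fun_prop
    simpa using this.tendsto 0
  filter_upwards [eventually_biNorm_add_smul_biField (A := A) (B := B) h1 h2,
    (continuous_biNorm.continuousAt.tendsto.comp ht).eventually hγ] with τ e1 e2
  rw [hg]
  refine e2.trans ?_
  rw [Function.comp_apply, e1, hA, hB, aff, aff]
  linear_combination τ * hab

/-- The perimeter in a ball of a biradial set with piecewise affine boundary is the limit of the
measures of its layers divided by their width. -/
theorem perim_biradial {a₁ b₁ c₁ a₂ b₂ c₂ : ℝ} (h₁ : a₁ ^ 2 + b₁ ^ 2 = 1)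
    (h₂ : a₂ ^ 2 + b₂ ^ 2 = 1) {r : ℝ} (hr : 0 < r) {γ : ℝ × ℝ → ℝ}
    (hγ : ∀ p, γ p = max (aff a₁ b₁ c₁ p) (aff a₂ b₂ c₂ p)) {L : ℝ}
    (hV : Tendsto (fun ε => biRad.real (planarLayer γ r ε) / ε) (𝓝[>] 0) (𝓝 L))
    (hbad : ∀ κ > 0, ∃ δ > 0, δ < r ∧ ∀ᶠ ε in 𝓝[>] 0, biRad.real
      (planarLayer γ r ε ∩ badSet (aff a₁ b₁ c₁) (aff a₂ b₂ c₂) r δ) ≤ κ * ε) :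
    perim {x | γ (biNorm x) ≤ 0} (ball 0 r) = ENNReal.ofReal L := by
  have hγc : Continuous γ := by
    rw [funext hγ]
    exact continuous_aff.max continuous_aff
  have hlayer (ε : ℝ) : ball (0 : Euc 8) r ∩ layer (fun x => γ (biNorm x)) ε
      = biNorm ⁻¹' planarLayer γ r ε := by
    ext x
    rw [mem_inter_iff, mem_ball_iff_biNorm hr.le]
    rfl
  refine perim_eq_of_tendsto_layer (g := fun x => γ (biNorm x)) ?_ isOpen_ball
    measure_ball_lt_top.ne ?_ fun κ hκ => ?_
  · simp only [hγ]
    exact lipschitzWith_max_aff_biNorm c₁ c₂ h₁ h₂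
  · simpa only [hlayer, biRad_real_apply (measurableSet_planarLayer hγc r _)] using hV
  obtain ⟨δ, hδ, hδr, hδε⟩ := hbad κ hκ
  set u : ℝ × ℝ → ℝ := fun p => aff a₁ b₁ c₁ p - aff a₂ b₂ c₂ p with hu
  have hmb := measurableSet_badSet (continuous_aff (a := a₁) (b := b₁) (c := c₁))
    (continuous_aff (a := a₂) (b := b₂) (c := c₂)) r δ
  let A : ℝ × ℝ → ℝ := fun p => quadCutoff r δ p * switch δ a₁ a₂ (u p)
  let B : ℝ × ℝ → ℝ := fun p => quadCutoff r δ p * switch δ b₁ b₂ (u p)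
  have hucd : ContDiff ℝ 1 u := contDiff_aff.sub contDiff_aff
  have hA : ContDiff ℝ 1 A := contDiff_quadCutoff.mul (contDiff_switch.comp hucd)
  have hB : ContDiff ℝ 1 B := contDiff_quadCutoff.mul (contDiff_switch.comp hucd)
  have hsupp : tsupport (biField A B) ⊆ closedBall 0 (r - δ / 2) :=
    tsupport_biField_subset (by linarith) fun p hp => by
      simp [A, B, quadCutoff_eq_zero_of_le hδ hδr hp]
  refine ⟨biField A B, contDiff_biField hA hB (half_pos hδ) fun p hp => ?_, ?_, ?_,
    norm_biField_le fun p => ?_, (biNorm ⁻¹' badSet (aff a₁ b₁ c₁) (aff a₂ b₂ c₂) r δ)ᶜ,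
    (continuous_biNorm.measurable hmb).compl, fun x hx hgx => ?_, ?_⟩
  · simp [A, B, quadCutoff_eq_zero_of_lt hδ hp]
  · exact (isCompact_closedBall _ _).of_isClosed_subset (isClosed_tsupport _) hsupp
  · exact hsupp.trans (closedBall_subset_ball (by linarith))
  · simp only [A, B, mul_pow, ← mul_add]
    exact mul_le_one₀ (pow_le_one₀ quadCutoff_nonneg quadCutoff_le_one) (by positivity)
      (sq_switch_add_sq_switch_le hδ h₁ h₂)
  · simp only [badSet, mem_compl_iff, mem_preimage, mem_ofPred_eq, not_or, not_le] at hx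
    obtain ⟨x1, x2, x3, x4⟩ := hx
    have hq := quadCutoff_eq_one hδ hδr x1 x2 x3
    rcases lt_abs.1 x4 with h | h
    · refine hasLineDerivAt_of_eventuallyEq_aff (c := c₁) (fun _ => rfl) (hδ.trans x1)
        (hδ.trans x2) ?_ ?_ h₁ ?_
      · simp [A, hq, switch_of_lt hδ (show δ < u (biNorm x) from h)]
      · simp [B, hq, switch_of_lt hδ (show δ < u (biNorm x) from h)]
      · filter_upwards [hucd.continuous.continuousAt.eventually (lt_mem_nhds (hδ.trans h))]
          with p hp
        rw [hγ, max_eq_left (sub_nonneg.1 hp.le)]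
    · have h' : u (biNorm x) < -δ := by simp only [hu]; linarith
      refine hasLineDerivAt_of_eventuallyEq_aff (c := c₂) (fun _ => rfl) (hδ.trans x1)
        (hδ.trans x2) ?_ ?_ h₂ ?_
      · simp [A, hq, switch_of_lt_neg hδ h']
      · simp [B, hq, switch_of_lt_neg hδ h']
      · filter_upwards [hucd.continuous.continuousAt.eventually
          (gt_mem_nhds (show u (biNorm x) < 0 by linarith))] with p hp
        rw [hγ, max_eq_right (sub_nonpos.1 hp.le)]
  · filter_upwards [hδε] with ε hε
    rwa [hlayer, sdiff_compl, ← preimage_inter,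
      ← biRad_real_apply ((measurableSet_planarLayer hγc r ε).inter hmb)]

/-- The distribution of the norm on `ℝ⁴` under Lebesgue measure. -/
def rad : Measure ℝ := (volume : Measure (Euc 4)).map norm

instance : SFinite rad := by unfold rad; infer_instance

lemma rad_apply {A : Set ℝ} (hA : MeasurableSet A) :
    rad A = volume ((norm : Euc 4 → ℝ) ⁻¹' A) := Measure.map_apply measurable_norm hA

lemma rad_Iic (b : ℝ) : rad (Iic b) = volume (closedBall (0 : Euc 4) b) := by
  rw [rad_apply measurableSet_Iic]
  congr 1
  ext x
  simp

instance : NullSingletonClass rad where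
  measure_singleton t := by
    rw [rad_apply (measurableSet_singleton t)]
    convert! Measure.addHaar_sphere (volume : Measure (Euc 4)) 0 t
    ext x
    simp

lemma rad_Iic_lt_top (b : ℝ) : rad (Iic b) < ⊤ := by
  rw [rad_Iic]
  exact measure_closedBall_lt_top

lemma volume_real_ball_four : volume.real (ball (0 : Euc 4) 1) = Real.pi ^ 2 / 2 := by
  have h1 : Real.Gamma ((4 : ℕ) / 2 + 1) = 2 := by
    rw [show ((4 : ℕ) / 2 + 1 : ℝ) = ((2 : ℕ) : ℝ) + 1 by norm_num, Real.Gamma_nat_eq_factorial]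
    norm_num
  rw [measureReal_def, EuclideanSpace.volume_ball, Fintype.card_fin, h1,
    show √Real.pi ^ 4 = Real.pi ^ 2 by
      rw [show 4 = 2 * 2 from rfl, pow_mul, Real.sq_sqrt Real.pi_pos.le]]
  simp only [ENNReal.ofReal_one, one_pow, one_mul]
  exact ENNReal.toReal_ofReal (by positivity)

lemma rad_real_Iic {b : ℝ} (hb : 0 ≤ b) : rad.real (Iic b) = Real.pi ^ 2 / 2 * b ^ 4 := by
  rw [measureReal_def, rad_Iic, ← measureReal_def, Measure.addHaar_real_closedBall _ _ hb,
    volume_real_ball_four, finrank_euclideanSpace_fin]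
  ring

lemma rad_real_Ioc {a b : ℝ} (ha : 0 ≤ a) (hab : a ≤ b) :
    rad.real (Ioc a b) = Real.pi ^ 2 / 2 * (b ^ 4 - a ^ 4) := by
  rw [← Iic_sdiff_Iic, measureReal_sdiff (Iic_subset_Iic.2 hab) measurableSet_Iic
    (rad_Iic_lt_top b).ne, rad_real_Iic ha, rad_real_Iic (ha.trans hab)]
  ring

lemma rad_real_Ioo {a b : ℝ} (ha : 0 ≤ a) (hab : a ≤ b) :
    rad.real (Ioo a b) = Real.pi ^ 2 / 2 * (b ^ 4 - a ^ 4) := by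
  rw [← rad_real_Ioc ha hab, measureReal_congr Ioo_ae_eq_Ioc]

lemma integral_rad {f : ℝ → ℝ} (hf : Measurable f) :
    ∫ t, f t ∂rad = 2 * Real.pi ^ 2 * ∫ t in Ioi (0 : ℝ), t ^ 3 * f t := by
  rw [rad, integral_map measurable_norm.aemeasurable hf.aestronglyMeasurable,
    integral_fun_norm_addHaar, volume_real_ball_four, finrank_euclideanSpace_fin]
  simp only [nsmul_eq_mul, smul_eq_mul]
  push_cast
  ring

/-- The isometry `ℝ⁸ ≃ ℝ⁴ × ℝ⁴`. -/
def splitEquiv : Euc 8 ≃ₗᵢ[ℝ] WithLp 2 (Euc 4 × Euc 4) :=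
  (LinearIsometryEquiv.piLpCongrLeft 2 ℝ ℝ (finSumFinEquiv (m := 4) (n := 4)).symm).trans
    (PiLp.sumPiLpEquivProdLpPiLp (𝕜 := ℝ) 2 (fun _ => ℝ))

lemma norm_splitEquiv_fst (x : Euc 8) : ‖(splitEquiv x).fst‖ = nlo x := by
  have h (i : Fin 4) : (splitEquiv x).fst i = x (Fin.castAdd 4 i) := rfl
  rw [EuclideanSpace.norm_eq, nlo]
  congr 1
  simp only [h, Real.norm_eq_abs, sq_abs]
  rw [Fin.sum_univ_add (a := 4) (b := 4)]
  simp

lemma norm_splitEquiv_snd (x : Euc 8) : ‖(splitEquiv x).snd‖ = nhi x := by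
  have h (i : Fin 4) : (splitEquiv x).snd i = x (Fin.natAdd 4 i) := rfl
  rw [EuclideanSpace.norm_eq, nhi]
  congr 1
  simp only [h, Real.norm_eq_abs, sq_abs]
  rw [Fin.sum_univ_add (a := 4) (b := 4)]
  simp

lemma biRad_eq_prod : biRad = rad.prod rad := by
  have h1 : MeasurePreserving (fun x : Euc 8 => WithLp.ofLp (splitEquiv x)) :=
    (WithLp.volume_preserving_ofLp (Euc 4) (Euc 4)).comp splitEquiv.measurePreserving
  have h2 : biNorm = Prod.map norm norm ∘ fun x : Euc 8 => WithLp.ofLp (splitEquiv x) := by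
    ext x
    · exact (norm_splitEquiv_fst x).symm
    · exact (norm_splitEquiv_snd x).symm
  rw [biRad, h2, ← Measure.map_map (measurable_norm.prodMap measurable_norm) h1.measurable,
    h1.map_eq, rad, Measure.map_prod_map _ _ measurable_norm measurable_norm]
  rfl

lemma biRad_real_prod (I J : Set ℝ) : biRad.real (I ×ˢ J) = rad.real I * rad.real J := by
  rw [biRad_eq_prod, measureReal_prod_prod]

lemma biRad_ne_top {T : Set (ℝ × ℝ)} (R : ℝ) (h : ∀ p ∈ T, p.1 ≤ R ∧ p.2 ≤ R) :
    biRad T ≠ ⊤ := by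
  refine ne_top_of_le_ne_top ?_ (measure_mono (show T ⊆ Iic R ×ˢ Iic R from h))
  rw [biRad_eq_prod, Measure.prod_prod]
  exact (ENNReal.mul_lt_top (rad_Iic_lt_top R) (rad_Iic_lt_top R)).ne

lemma rad_Iic_zero : rad (Iic 0) = 0 := by
  rw [rad_Iic, closedBall_zero, measure_singleton]

lemma ae_biRad_pos : ∀ᵐ p ∂biRad, 0 < p.1 ∧ 0 < p.2 := by
  have h : ∀ᵐ t ∂rad, 0 < t := by
    rw [ae_iff]
    simpa [Iic_def] using rad_Iic_zero
  rw [biRad_eq_prod]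
  filter_upwards [Measure.quasiMeasurePreserving_fst.ae h,
    Measure.quasiMeasurePreserving_snd.ae h] with p h1 h2 using ⟨h1, h2⟩

lemma biRad_real_mono {A T : Set (ℝ × ℝ)} (hT : biRad T ≠ ⊤)
    (h : ∀ p ∈ A, 0 < p.1 → 0 < p.2 → p ∈ T) : biRad.real A ≤ biRad.real T := by
  refine ENNReal.toReal_mono hT (measure_mono_ae ?_)
  filter_upwards [ae_biRad_pos] with p hp hA using h p hA hp.1 hp.2

lemma biRad_real_swap (A : Set (ℝ × ℝ)) : biRad.real (Prod.swap ⁻¹' A) = biRad.real A := by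
  rw [measureReal_def, measureReal_def, biRad_eq_prod]
  congr 1
  exact (Measure.measurePreserving_swap (μ := rad) (ν := rad)).measure_preimage_equiv
    (f := MeasurableEquiv.prodComm) A

/-- The part of the plane with second coordinate in `[a, b)` lying less than `h` to the right of
the diagonal. -/
def strip (a b h : ℝ) : Set (ℝ × ℝ) := {p | (a ≤ p.2 ∧ p.2 < b) ∧ p.2 < p.1 ∧ p.1 < p.2 + h}

lemma measurableSet_strip (a b h : ℝ) : MeasurableSet (strip a b h) :=
  ((measurableSet_le measurable_const measurable_snd).inter
    (measurableSet_lt measurable_snd measurable_const)).inter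
    ((measurableSet_lt measurable_snd measurable_fst).inter
      (measurableSet_lt measurable_fst (measurable_snd.add_const h)))

lemma biRad_strip_ne_top {a b h : ℝ} (hh : 0 ≤ h) : biRad (strip a b h) ≠ ⊤ :=
  biRad_ne_top (b + h) fun p hp => ⟨by linarith [hp.1.2, hp.2.2], by linarith [hp.1.2]⟩

lemma biRad_real_strip {a b h : ℝ} (ha : 0 ≤ a) (hab : a ≤ b) (hh : 0 ≤ h) :
    biRad.real (strip a b h) =
      Real.pi ^ 4 * ∫ t in a..b, t ^ 3 * ((t + h) ^ 4 - t ^ 4) := by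
  have hsec (t : ℝ) : rad.real ((fun s => (s, t)) ⁻¹' strip a b h) =
      (Ico a b).indicator (fun t => Real.pi ^ 2 / 2 * ((t + h) ^ 4 - t ^ 4)) t := by
    by_cases ht : t ∈ Ico a b
    · rw [indicator_of_mem ht, ← rad_real_Ioo (ha.trans ht.1) (by linarith)]
      congr 1
      ext s
      simp [strip, ht.1, ht.2]
    · rw [indicator_of_notMem ht]
      convert! measureReal_empty (μ := rad)
      ext s
      simp only [strip, preimage_ofPred_eq, mem_ofPred_eq, mem_empty_iff_false, iff_false]
      exact fun hs => ht hs.1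
  have hfin : ∀ᵐ t ∂rad, rad ((fun s => (s, t)) ⁻¹' strip a b h) < ⊤ :=
    ae_of_all _ fun t => (measure_mono fun s hs => le_of_lt hs.2.2).trans_lt
      (rad_Iic_lt_top (t + h))
  rw [measureReal_def, biRad_eq_prod, Measure.prod_apply_symm (measurableSet_strip a b h),
    ← integral_toReal (measurable_measure_prodMk_right (measurableSet_strip a b h)).aemeasurable
      hfin]
  simp only [← measureReal_def, hsec]
  rw [integral_rad (Measurable.indicator (by fun_prop) measurableSet_Ico),
    intervalIntegral.integral_of_le hab, ← integral_Ico_eq_integral_Ioc]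
  have hind (t : ℝ) : t ^ 3 * (Ico a b).indicator
      (fun t => Real.pi ^ 2 / 2 * ((t + h) ^ 4 - t ^ 4)) t = (Ico a b).indicator
      (fun t => Real.pi ^ 2 / 2 * (t ^ 3 * ((t + h) ^ 4 - t ^ 4))) t := by
    by_cases ht : t ∈ Ico a b
    · simp only [indicator_of_mem ht]
      ring
    · simp only [indicator_of_notMem ht, mul_zero]
  simp only [hind]
  rw [setIntegral_indicator measurableSet_Ico]
  have hI : ∫ t in Ioi 0 ∩ Ico a b, Real.pi ^ 2 / 2 * (t ^ 3 * ((t + h) ^ 4 - t ^ 4)) =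
      ∫ t in Ico a b, Real.pi ^ 2 / 2 * (t ^ 3 * ((t + h) ^ 4 - t ^ 4)) := by
    refine setIntegral_congr_set ?_
    have := ae_eq_set_inter (Ioi_ae_eq_Ici (μ := volume) (a := (0 : ℝ)))
      (ae_eq_refl (Ico a b))
    rwa [inter_eq_right.2 fun t (ht : t ∈ Ico a b) => mem_Ici.2 (ha.trans ht.1)] at this
  rw [hI, integral_const_mul]
  ring

/-- The polynomial governing the mass of a strip. -/
def stripPoly (h t : ℝ) : ℝ :=
  Real.pi ^ 4 * (4 / 7 * t ^ 7 + h * t ^ 6 + 4 / 5 * h ^ 2 * t ^ 5 + 1 / 4 * h ^ 3 * t ^ 4)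

lemma biRad_real_strip_eq {a b h : ℝ} (ha : 0 ≤ a) (hab : a ≤ b) (hh : 0 ≤ h) :
    biRad.real (strip a b h) = h * (stripPoly h b - stripPoly h a) := by
  have hd (t : ℝ) : HasDerivAt (fun t => h * stripPoly h t / Real.pi ^ 4)
      (t ^ 3 * ((t + h) ^ 4 - t ^ 4)) t := by
    have := (((((hasDerivAt_pow 7 t).const_mul (4 / 7)).add
      ((hasDerivAt_pow 6 t).const_mul h)).add
      ((hasDerivAt_pow 5 t).const_mul (4 / 5 * h ^ 2))).add
      ((hasDerivAt_pow 4 t).const_mul (1 / 4 * h ^ 3))).const_mul h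
    refine (this.congr_deriv ?_).congr_of_eventuallyEq (Eventually.of_forall fun s => ?_)
    · push_cast
      ring
    · simp only [stripPoly, Pi.add_apply]
      field_simp
  rw [biRad_real_strip ha hab hh, intervalIntegral.integral_eq_sub_of_hasDerivAt
    (fun t _ => hd t) ((by fun_prop : Continuous _).intervalIntegrable _ _)]
  field_simp

lemma biRad_real_strip_le {a b h R : ℝ} (ha : 0 ≤ a) (hab : a ≤ b) (hb : b ≤ R) (hh : 0 ≤ h)
    (h1 : h ≤ 1) :
    biRad.real (strip a b h) ≤ Real.pi ^ 4 * (4 * (R + 1) ^ 6) * (h * (b - a)) := by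
  have hbd : ‖∫ t in a..b, t ^ 3 * ((t + h) ^ 4 - t ^ 4)‖ ≤
      (4 * (R + 1) ^ 6 * h) * |b - a| := by
    refine intervalIntegral.norm_integral_le_of_norm_le_const fun t ht => ?_
    rw [uIoc_of_le hab] at ht
    have ht0 : 0 ≤ t := ha.trans ht.1.le
    have ht1 : t + h ≤ R + 1 := by linarith [ht.2]
    have e : (t + h) ^ 4 - t ^ 4 =
      h * ((t + h) ^ 3 + (t + h) ^ 2 * t + (t + h) * t ^ 2 + t ^ 3) := by ring
    have b1 : t ≤ R + 1 := by linarith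
    have b0 : 0 ≤ R + 1 := by linarith
    have b2 : (t + h) ^ 3 + (t + h) ^ 2 * t + (t + h) * t ^ 2 + t ^ 3 ≤
        (R + 1) ^ 3 + (R + 1) ^ 2 * (R + 1) + (R + 1) * (R + 1) ^ 2 + (R + 1) ^ 3 := by
      gcongr
    rw [e, Real.norm_of_nonneg (by positivity)]
    calc t ^ 3 * (h * ((t + h) ^ 3 + (t + h) ^ 2 * t + (t + h) * t ^ 2 + t ^ 3))
        ≤ (R + 1) ^ 3 * (h * ((R + 1) ^ 3 + (R + 1) ^ 2 * (R + 1) + (R + 1) * (R + 1) ^ 2 +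
          (R + 1) ^ 3)) := by gcongr
      _ = 4 * (R + 1) ^ 6 * h := by ring
  rw [abs_of_nonneg (by linarith)] at hbd
  rw [biRad_real_strip ha hab hh]
  calc _ ≤ Real.pi ^ 4 * ((4 * (R + 1) ^ 6 * h) * (b - a)) := by
        gcongr
        exact (le_abs_self _).trans hbd
    _ = _ := by ring

lemma rad_real_Ioo_le {a b : ℝ} (ha : 0 ≤ a) (hab : a ≤ b) (hb : b ≤ 2) :
    rad.real (Ioo a b) ≤ 16 * Real.pi ^ 2 * (b - a) := by
  have h2 : b ^ 3 + b ^ 2 * a + b * a ^ 2 + a ^ 3 ≤ 2 ^ 3 + 2 ^ 2 * 2 + 2 * 2 ^ 2 + 2 ^ 3 := by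
    have : a ≤ 2 := hab.trans hb
    have : 0 ≤ b := ha.trans hab
    gcongr
  rw [rad_real_Ioo ha hab]
  calc _ = Real.pi ^ 2 / 2 * ((b ^ 3 + b ^ 2 * a + b * a ^ 2 + a ^ 3) * (b - a)) := by ring
    _ ≤ Real.pi ^ 2 / 2 * ((2 ^ 3 + 2 ^ 2 * 2 + 2 * 2 ^ 2 + 2 ^ 3) * (b - a)) := by
        have : 0 ≤ b - a := by linarith
        gcongr
    _ = _ := by ring

lemma rect_le {a b c d : ℝ} (ha : 0 ≤ a) (hab : a ≤ b) (hb : b ≤ 2) (hc : 0 ≤ c) (hcd : c ≤ d)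
    (hd : d ≤ 2) :
    biRad.real (Ioo a b ×ˢ Ioo c d) ≤ 256 * Real.pi ^ 4 * ((b - a) * (d - c)) := by
  rw [biRad_real_prod]
  calc _ ≤ 16 * Real.pi ^ 2 * (b - a) * (16 * Real.pi ^ 2 * (d - c)) :=
        mul_le_mul (rad_real_Ioo_le ha hab hb) (rad_real_Ioo_le hc hcd hd) measureReal_nonneg
          (by have : 0 ≤ b - a := by linarith
              positivity)
    _ = _ := by ring

lemma biRad_rect_ne_top (a b c d : ℝ) : biRad (Ioo a b ×ˢ Ioo c d) ≠ ⊤ :=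
  biRad_ne_top (max b d) fun _ hp =>
    ⟨hp.1.2.le.trans (le_max_left _ _), hp.2.2.le.trans (le_max_right _ _)⟩

lemma tendsto_div_of_bounds {V f g : ℝ → ℝ} {L : ℝ} (hf : Continuous f) (hg : Continuous g)
    (hf0 : f 0 = L) (hg0 : g 0 = L) (hfV : ∀ᶠ ε in 𝓝[>] (0 : ℝ), ε * f ε ≤ V ε)
    (hVg : ∀ᶠ ε in 𝓝[>] (0 : ℝ), V ε ≤ ε * g ε) :
    Tendsto (fun ε => V ε / ε) (𝓝[>] 0) (𝓝 L) := by
  refine tendsto_of_tendsto_of_tendsto_of_le_of_le'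
    (hf0 ▸ (hf.tendsto 0).mono_left nhdsWithin_le_nhds)
    (hg0 ▸ (hg.tendsto 0).mono_left nhdsWithin_le_nhds) ?_ ?_
  · filter_upwards [hfV, self_mem_nhdsWithin] with ε h (hε : 0 < ε)
    rw [le_div_iff₀ hε]
    linarith
  · filter_upwards [hVg, self_mem_nhdsWithin] with ε h (hε : 0 < ε)
    rw [div_le_iff₀ hε]
    linarith

lemma eventually_pos_lt {c : ℝ} (hc : 0 < c) : ∀ᶠ ε in 𝓝[>] (0 : ℝ), 0 < ε ∧ ε < c :=
  Ioo_mem_nhdsGT hc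

lemma perim_biradial_swap {a₁ b₁ c₁ a₂ b₂ c₂ r L : ℝ} {γ : ℝ × ℝ → ℝ}
    (h₁ : a₁ ^ 2 + b₁ ^ 2 = 1) (h₂ : a₂ ^ 2 + b₂ ^ 2 = 1) (hr : 0 < r)
    (hγ : ∀ p, γ p = max (aff a₁ b₁ c₁ p) (aff a₂ b₂ c₂ p))
    (hV : Tendsto (fun ε => biRad.real (planarLayer γ r ε) / ε) (𝓝[>] 0) (𝓝 L))
    (hbad : ∀ κ > 0, ∃ δ > 0, δ < r ∧ ∀ᶠ ε in 𝓝[>] (0 : ℝ),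
      biRad.real (planarLayer γ r ε ∩ badSet (aff a₁ b₁ c₁) (aff a₂ b₂ c₂) r δ) ≤ κ * ε) :
    perim {x | γ (biNorm x).swap ≤ 0} (ball 0 r) = ENNReal.ofReal L := by
  have hl (ε : ℝ) : planarLayer (fun p => γ p.swap) r ε = Prod.swap ⁻¹' planarLayer γ r ε := by
    ext p
    simp [planarLayer, add_comm]
  have hb (δ : ℝ) : badSet (aff b₁ a₁ c₁) (aff b₂ a₂ c₂) r δ =
      Prod.swap ⁻¹' badSet (aff a₁ b₁ c₁) (aff a₂ b₂ c₂) r δ := by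
    ext p
    simp only [badSet, aff, mem_preimage, mem_ofPred_eq, Prod.fst_swap, Prod.snd_swap,
      add_comm (p.1 ^ 2), add_comm (b₁ * p.1), add_comm (b₂ * p.1)]
    tauto
  refine perim_biradial (γ := fun p => γ p.swap) (a₁ := b₁) (b₁ := a₁) (c₁ := c₁) (a₂ := b₂)
    (b₂ := a₂) (c₂ := c₂) (by linarith) (by linarith) hr (fun p => ?_) ?_ fun κ hκ => ?_
  · rw [hγ]
    simp only [aff, Prod.fst_swap, Prod.snd_swap, add_comm]
  · simpa only [hl, biRad_real_swap] using hV
  · obtain ⟨δ, h0, h1, h2⟩ := hbad κ hκ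
    refine ⟨δ, h0, h1, ?_⟩
    simpa only [hl, hb, ← preimage_inter, biRad_real_swap] using h2

lemma sqrt_two_bounds : 1 < √(2 : ℝ) ∧ √(2 : ℝ) < 3 / 2 :=
  ⟨Real.lt_sqrt_of_sq_lt (by norm_num), (Real.sqrt_lt' (by norm_num)).2 (by norm_num)⟩

/-- The signed distance to the diagonal. -/
def diagDist : ℝ × ℝ → ℝ := aff (1 / √2) (-(1 / √2)) 0

lemma diagDist_eq (p : ℝ × ℝ) : diagDist p = (p.1 - p.2) / √2 := by
  simp only [diagDist, aff]
  ring

lemma diagDist_coeff : (1 / √2 : ℝ) ^ 2 + (-(1 / √2)) ^ 2 = 1 := by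
  rw [neg_sq, div_pow, Real.sq_sqrt (by norm_num)]
  norm_num

lemma diagDist_pos {p : ℝ × ℝ} : 0 < diagDist p ↔ p.2 < p.1 := by
  rw [diagDist_eq, div_pos_iff_of_pos_right (by positivity), sub_pos]

lemma diagDist_lt {p : ℝ × ℝ} {ε : ℝ} : diagDist p < ε ↔ p.1 < p.2 + √2 * ε := by
  rw [diagDist_eq, div_lt_iff₀ (by positivity)]
  constructor <;> intro h <;> linarith

lemma lt_of_sq_add_sq_lt {s t ρ : ℝ} (hρ : 0 ≤ ρ) (hts : t < s) (ht : 0 < t)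
    (h : s ^ 2 + t ^ 2 < (√2 * ρ) ^ 2) : t < ρ := by
  rw [mul_pow, Real.sq_sqrt (by norm_num)] at h
  nlinarith

lemma le_of_le_sq_add_sq {s t ρ δ h : ℝ} (hδ : 0 < δ) (hδρ : δ < ρ) (hh : h ≤ δ) (ht : 0 < t)
    (hs : 0 < s) (hst : s < t + h) (hb : (√2 * ρ - δ) ^ 2 ≤ s ^ 2 + t ^ 2) : ρ - 2 * δ ≤ t := by
  by_contra! hlt
  have h1 : s < ρ - δ := by linarith
  have h2 : s ^ 2 + t ^ 2 < 2 * (ρ - δ) ^ 2 := by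
    have := pow_lt_pow_left₀ h1 hs.le two_ne_zero
    have := pow_lt_pow_left₀ (show t < ρ - δ by linarith) ht.le two_ne_zero
    linarith
  have h3 : (√2 * (ρ - δ)) ^ 2 ≤ (√2 * ρ - δ) ^ 2 := by
    have := sqrt_two_bounds.1
    have : 0 ≤ ρ - δ := by linarith
    exact pow_le_pow_left₀ (by positivity) (by nlinarith) 2
  rw [mul_pow, Real.sq_sqrt (by norm_num)] at h3
  linarith

lemma tendsto_layer_diag {ρ : ℝ} (hρ : 0 < ρ) :
    Tendsto (fun ε => biRad.real (planarLayer diagDist (√2 * ρ) ε) / ε) (𝓝[>] 0)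
      (𝓝 (√2 * stripPoly 0 ρ)) := by
  have h2 := sqrt_two_bounds
  refine tendsto_div_of_bounds
    (f := fun ε => √2 * (stripPoly (√2 * ε) (ρ - √2 * ε) - stripPoly (√2 * ε) 0))
    (g := fun ε => √2 * (stripPoly (√2 * ε) ρ - stripPoly (√2 * ε) 0))
    (by unfold stripPoly; fun_prop) (by unfold stripPoly; fun_prop)
    (by simp [stripPoly]) (by simp [stripPoly]) ?_ ?_
  · filter_upwards [eventually_pos_lt (c := ρ / 2) (by positivity)] with ε hε
    have hh : √2 * ε ≤ ρ := by nlinarith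
    have hh0 : 0 < √2 * ε := by nlinarith
    calc _ = biRad.real (strip 0 (ρ - √2 * ε) (√2 * ε)) := by
          rw [biRad_real_strip_eq le_rfl (by linarith) hh0.le]
          ring
      _ ≤ _ := by
          refine biRad_real_mono (biRad_ne_top (√2 * ρ) ?_) ?_
          · intro p hp
            have := hp.1
            constructor <;> refine le_of_lt (abs_lt_of_sq_lt_sq' ?_ (by positivity)).2 <;>
              nlinarith [sq_nonneg p.1, sq_nonneg p.2]
          · rintro p ⟨⟨-, h1⟩, h3, h4⟩ - hp
            refine ⟨?_, ?_⟩
            · rw [mul_pow, Real.sq_sqrt (by norm_num)]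
              have e1 : p.1 < ρ := by linarith
              have e2 : p.2 < ρ := by linarith
              nlinarith
            · rw [diagDist_pos, diagDist_lt]
              exact ⟨h3, h4⟩
  · filter_upwards [eventually_pos_lt one_pos] with ε hε
    have hh0 : 0 < √2 * ε := by nlinarith
    calc _ ≤ biRad.real (strip 0 ρ (√2 * ε)) := by
          refine biRad_real_mono (biRad_strip_ne_top hh0.le) ?_
          rintro p ⟨h1, h3, h4⟩ - hp
          rw [diagDist_pos] at h3
          rw [diagDist_lt] at h4
          exact ⟨⟨hp.le, lt_of_sq_add_sq_lt hρ.le h3 hp h1⟩, h3, h4⟩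
      _ = _ := by
          rw [biRad_real_strip_eq le_rfl hρ.le hh0.le]
          ring

lemma bad_layer_diag {ρ : ℝ} (hρ : 2 ≤ ρ)
    {κ : ℝ} (hκ : 0 < κ) :
    ∃ δ > 0, δ < √2 * ρ ∧ ∀ᶠ ε in 𝓝[>] (0 : ℝ),
      biRad.real (planarLayer diagDist (√2 * ρ) ε ∩
        badSet diagDist (aff (1 / √2) (-(1 / √2)) 1) (√2 * ρ) δ) ≤ κ * ε := by
  have h2 := sqrt_two_bounds
  have hdiff (p : ℝ × ℝ) : diagDist p - aff (1 / √2) (-(1 / √2)) 1 p = 1 := by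
    simp only [diagDist, aff]
    ring
  set M := Real.pi ^ 4 * (4 * (ρ + 1) ^ 6) with hM
  have hM0 : 0 < M := by positivity
  set δ := min (1 / 2) (κ / (8 * M)) with hδ
  have hδ0 : 0 < δ := by positivity
  have hδ1 : δ ≤ 1 / 2 := min_le_left _ _
  have hδκ : 8 * M * δ ≤ κ := by
    have := min_le_right (1 / 2) (κ / (8 * M))
    rw [← hδ, le_div_iff₀ (by positivity)] at this
    linarith
  refine ⟨δ, hδ0, by nlinarith, ?_⟩
  filter_upwards [eventually_pos_lt (c := δ / 2) (by positivity)] with ε ⟨hε0, hε⟩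
  have hh0 : 0 < √2 * ε := by positivity
  have hhδ : √2 * ε ≤ δ := by nlinarith
  calc _ ≤ biRad.real (strip 0 (2 * δ) (√2 * ε) ∪ strip (ρ - 2 * δ) ρ (√2 * ε)) := by
        refine biRad_real_mono
          (measure_union_ne_top (biRad_strip_ne_top hh0.le) (biRad_strip_ne_top hh0.le)) ?_
        rintro p ⟨⟨h1, h3, h4⟩, hb⟩ hp1 hp2
        rw [diagDist_pos] at h3
        rw [diagDist_lt] at h4
        rcases hb with hb | hb | hb | hb
        · exact Or.inl ⟨⟨hp2.le, by linarith⟩, h3, h4⟩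
        · exact Or.inl ⟨⟨hp2.le, by linarith⟩, h3, h4⟩
        · exact Or.inr ⟨⟨le_of_le_sq_add_sq hδ0 (by linarith) hhδ hp2 hp1 h4 hb,
            lt_of_sq_add_sq_lt (by linarith) h3 hp2 h1⟩, h3, h4⟩
        · rw [hdiff, abs_one] at hb
          linarith
    _ ≤ M * (√2 * ε * (2 * δ - 0)) + M * (√2 * ε * (ρ - (ρ - 2 * δ))) := by
        refine (measureReal_union_le _ _).trans (add_le_add ?_ ?_)
        · exact biRad_real_strip_le le_rfl (by linarith) (by linarith) hh0.le (by linarith)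
        · exact biRad_real_strip_le (by linarith) (by linarith) le_rfl hh0.le (by linarith)
    _ = 4 * M * δ * √2 * ε := by ring
    _ ≤ κ * ε := by
        have : 4 * M * δ * √2 ≤ 4 * M * δ * 2 := by gcongr; linarith
        gcongr
        linarith

lemma perim_biradial_diag {ρ : ℝ} (hρ : 2 ≤ ρ) :
    perim {x | diagDist (biNorm x) ≤ 0} (ball 0 (√2 * ρ)) =
        ENNReal.ofReal (√2 * stripPoly 0 ρ) ∧
      perim {x | diagDist (biNorm x).swap ≤ 0} (ball 0 (√2 * ρ)) =
        ENNReal.ofReal (√2 * stripPoly 0 ρ) := by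
  have hγ (p : ℝ × ℝ) : diagDist p =
      max (aff (1 / √2) (-(1 / √2)) 0 p) (aff (1 / √2) (-(1 / √2)) 1 p) := by
    rw [max_eq_left (by simp only [aff]; linarith)]
    rfl
  exact ⟨perim_biradial diagDist_coeff diagDist_coeff (by positivity) hγ
      (tendsto_layer_diag (by positivity))
      fun κ hκ => bad_layer_diag hρ hκ,
    perim_biradial_swap diagDist_coeff diagDist_coeff (by positivity) hγ
      (tendsto_layer_diag (by positivity))
      fun κ hκ => bad_layer_diag hρ hκ⟩

lemma biRad_real_rect {a b c d : ℝ} (ha : 0 ≤ a) (hab : a ≤ b) (hc : 0 ≤ c) (hcd : c ≤ d) :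
    biRad.real (Ioo a b ×ˢ Ioo c d) = Real.pi ^ 4 / 4 * ((b ^ 4 - a ^ 4) * (d ^ 4 - c ^ 4)) := by
  rw [biRad_real_prod, rad_real_Ioo ha hab, rad_real_Ioo hc hcd]
  ring

/-- The function whose nonpositivity describes the outer region above the diagonal. -/
def outerDist (p : ℝ × ℝ) : ℝ := max (diagDist p) (aff 0 (-1) (-1) p)

lemma outerDist_pos {p : ℝ × ℝ} : 0 < outerDist p ↔ p.2 < p.1 ∨ p.2 < 1 := by
  rw [outerDist, lt_max_iff, diagDist_pos]
  simp [aff]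

lemma outerDist_lt {p : ℝ × ℝ} {ε : ℝ} :
    outerDist p < ε ↔ p.1 < p.2 + √2 * ε ∧ 1 - ε < p.2 := by
  rw [outerDist, max_lt_iff, diagDist_lt]
  refine and_congr Iff.rfl ?_
  simp only [aff]
  constructor <;> intro h <;> linarith

lemma tendsto_layer_outer {ρ : ℝ} (hρ : 2 < ρ) :
    Tendsto (fun ε => biRad.real (planarLayer outerDist (√2 * ρ) ε) / ε) (𝓝[>] 0)
      (𝓝 (√2 * (stripPoly 0 ρ - stripPoly 0 1) + Real.pi ^ 4)) := by
  have h2 := sqrt_two_bounds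
  refine tendsto_div_of_bounds
    (f := fun ε => √2 * (stripPoly (√2 * ε) (ρ - √2 * ε) - stripPoly (√2 * ε) 1) +
      Real.pi ^ 4 / 4 * ((1 - ε) ^ 4 * (4 - 6 * ε + 4 * ε ^ 2 - ε ^ 3)))
    (g := fun ε => √2 * (stripPoly (√2 * ε) ρ - stripPoly (√2 * ε) 1) +
      Real.pi ^ 4 / 4 * ((1 + √2 * ε) ^ 4 * (4 - 6 * ε + 4 * ε ^ 2 - ε ^ 3)))
    (by unfold stripPoly; fun_prop) (by unfold stripPoly; fun_prop)
    (by simp) (by simp) ?_ ?_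
  · filter_upwards [eventually_pos_lt (c := 1 / 2) (by positivity)] with ε ⟨hε0, hε⟩
    have hh : √2 * ε ≤ 3 / 4 := by nlinarith
    have hh0 : 0 < √2 * ε := by positivity
    calc _ = biRad.real (strip 1 (ρ - √2 * ε) (√2 * ε)) +
          biRad.real (Ioo 0 (1 - ε) ×ˢ Ioo (1 - ε) 1) := by
          rw [biRad_real_strip_eq zero_le_one (by linarith) hh0.le,
            biRad_real_rect le_rfl (by linarith) (by linarith) (by linarith)]
          ring
      _ = biRad.real (strip 1 (ρ - √2 * ε) (√2 * ε) ∪ Ioo 0 (1 - ε) ×ˢ Ioo (1 - ε) 1) := by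
          refine (measureReal_union ?_ (measurableSet_Ioo.prod measurableSet_Ioo)
            (biRad_strip_ne_top hh0.le) (biRad_rect_ne_top _ _ _ _)).symm
          exact disjoint_left.2 fun p hp hp' => hp'.2.2.not_ge hp.1.1
      _ ≤ _ := by
          refine biRad_real_mono (biRad_ne_top (√2 * ρ) ?_) ?_
          · intro p hp
            have := hp.1
            constructor <;> refine le_of_lt (abs_lt_of_sq_lt_sq' ?_ (by positivity)).2 <;>
              nlinarith [sq_nonneg p.1, sq_nonneg p.2]
          · intro p hp hp1 hp2
            rw [planarLayer, mem_ofPred_eq, outerDist_pos, outerDist_lt, mul_pow,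
              Real.sq_sqrt (by norm_num)]
            rcases hp with ⟨⟨h0, h1⟩, h3, h4⟩ | ⟨⟨h0, h1⟩, h3, h4⟩
            · have e1 : p.1 < ρ := by linarith
              have e2 : p.2 < ρ := by linarith
              exact ⟨by nlinarith, Or.inl h3, h4, by linarith⟩
            · have e1 : p.1 < ρ := by linarith
              have e2 : p.2 < ρ := by linarith
              exact ⟨by nlinarith, Or.inr h4, by linarith, h3⟩
  · filter_upwards [eventually_pos_lt one_pos] with ε ⟨hε0, hε⟩
    have hh0 : 0 < √2 * ε := by positivity
    calc _ ≤ biRad.real (strip 1 ρ (√2 * ε) ∪ Ioo 0 (1 + √2 * ε) ×ˢ Ioo (1 - ε) 1) := by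
          refine biRad_real_mono
            (measure_union_ne_top (biRad_strip_ne_top hh0.le) (biRad_rect_ne_top _ _ _ _)) ?_
          rintro p ⟨h1, h3, h4⟩ hp1 hp2
          rw [outerDist_pos] at h3
          rw [outerDist_lt] at h4
          rcases lt_or_ge p.2 1 with ht | ht
          · exact Or.inr ⟨⟨hp1, by linarith⟩, h4.2, ht⟩
          · have hd : p.2 < p.1 := h3.resolve_right ht.not_gt
            exact Or.inl ⟨⟨ht, lt_of_sq_add_sq_lt (by linarith) hd hp2 h1⟩, hd, h4.1⟩
      _ ≤ biRad.real (strip 1 ρ (√2 * ε)) +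
          biRad.real (Ioo 0 (1 + √2 * ε) ×ˢ Ioo (1 - ε) 1) := measureReal_union_le _ _
      _ = _ := by
          rw [biRad_real_strip_eq zero_le_one (by linarith) hh0.le,
            biRad_real_rect le_rfl (by linarith) (by linarith) (by linarith)]
          ring

lemma bad_layer_outer {ρ : ℝ} (hρ : 3 ≤ ρ) {κ : ℝ} (hκ : 0 < κ) :
    ∃ δ > 0, δ < √2 * ρ ∧ ∀ᶠ ε in 𝓝[>] (0 : ℝ),
      biRad.real (planarLayer outerDist (√2 * ρ) ε ∩
        badSet diagDist (aff 0 (-1) (-1)) (√2 * ρ) δ) ≤ κ * ε := by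
  have h2 := sqrt_two_bounds
  set M := Real.pi ^ 4 * (4 * (ρ + 1) ^ 6) with hM
  have hM0 : 0 < M := by positivity
  set N := 256 * Real.pi ^ 4 with hN
  have hN0 : 0 < N := by positivity
  set δ := min (1 / 4) (κ / (8 * M + 8 * N)) with hδ
  have hδ0 : 0 < δ := by positivity
  have hδ1 : δ ≤ 1 / 4 := min_le_left _ _
  have hδκ : (8 * M + 8 * N) * δ ≤ κ := by
    have := min_le_right (1 / 4) (κ / (8 * M + 8 * N))
    rw [← hδ, le_div_iff₀ (by positivity)] at this
    linarith
  refine ⟨δ, hδ0, by nlinarith, ?_⟩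
  filter_upwards [eventually_pos_lt (c := δ / 2) (by positivity)] with ε ⟨hε0, hε⟩
  have hh0 : 0 < √2 * ε := by positivity
  have hhδ : √2 * ε ≤ δ := by nlinarith
  calc _ ≤ biRad.real ((strip 1 (1 + 2 * δ) (√2 * ε) ∪ strip (ρ - 2 * δ) ρ (√2 * ε)) ∪
        (Ioo 0 (2 * δ) ×ˢ Ioo (1 - ε) 1 ∪ Ioo (1 - 3 * δ) (1 + 3 * δ) ×ˢ Ioo (1 - ε) 1)) := by
        refine biRad_real_mono
          (measure_union_ne_top
            (measure_union_ne_top (biRad_strip_ne_top hh0.le) (biRad_strip_ne_top hh0.le))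
            (measure_union_ne_top (biRad_rect_ne_top _ _ _ _) (biRad_rect_ne_top _ _ _ _))) ?_
        rintro p ⟨⟨h1, h3, h4⟩, hb⟩ hp1 hp2
        rw [outerDist_pos] at h3
        rw [outerDist_lt] at h4
        have e : √2 * diagDist p = p.1 - p.2 := by
          rw [diagDist_eq]
          field_simp
        have e' : aff 0 (-1) (-1) p = 1 - p.2 := by
          simp only [aff]
          ring
        rcases lt_or_ge p.2 1 with ht | ht
        · right
          rcases hb with hb | hb | hb | hb
          · exact Or.inl ⟨⟨hp1, by linarith⟩, h4.2, ht⟩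
          · linarith [h4.2]
          · exfalso
            have := le_of_le_sq_add_sq hδ0 (by linarith) hhδ hp2 hp1 h4.1 hb
            linarith
          · rw [e', abs_le] at hb
            have h5 : -δ ≤ diagDist p := by linarith
            have h6 : √2 * -δ ≤ √2 * diagDist p := by gcongr
            exact Or.inr ⟨⟨by nlinarith, by linarith⟩, h4.2, ht⟩
        · have hd : p.2 < p.1 := h3.resolve_right ht.not_gt
          have hlt := lt_of_sq_add_sq_lt (by linarith) hd hp2 h1
          left
          rcases hb with hb | hb | hb | hb
          · linarith
          · linarith
          · exact Or.inr ⟨⟨le_of_le_sq_add_sq hδ0 (by linarith) hhδ hp2 hp1 h4.1 hb, hlt⟩,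
              hd, h4.1⟩
          · rw [e', abs_le] at hb
            exact Or.inl ⟨⟨ht, by linarith [diagDist_pos.2 hd]⟩, hd, h4.1⟩
    _ ≤ (M * (√2 * ε * (1 + 2 * δ - 1)) + M * (√2 * ε * (ρ - (ρ - 2 * δ)))) +
        (N * ((2 * δ - 0) * (1 - (1 - ε))) +
          N * ((1 + 3 * δ - (1 - 3 * δ)) * (1 - (1 - ε)))) := by
        refine (measureReal_union_le _ _).trans (add_le_add
          ((measureReal_union_le _ _).trans (add_le_add ?_ ?_))
          ((measureReal_union_le _ _).trans (add_le_add ?_ ?_)))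
        · exact biRad_real_strip_le zero_le_one (by linarith) (by linarith) hh0.le (by linarith)
        · exact biRad_real_strip_le (by linarith) (by linarith) le_rfl hh0.le (by linarith)
        · exact rect_le le_rfl (by linarith) (by linarith) (by linarith) (by linarith)
            (by linarith)
        · exact rect_le (by linarith) (by linarith) (by linarith) (by linarith) (by linarith)
            (by linarith)
    _ = (4 * M * δ * √2 + 8 * N * δ) * ε := by ring
    _ ≤ κ * ε := by
        have : 4 * M * δ * √2 ≤ 4 * M * δ * 2 := by gcongr; linarith
        gcongr
        linarith

lemma perim_biradial_outer {ρ : ℝ} (hρ : 3 ≤ ρ) :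
    perim {x | outerDist (biNorm x) ≤ 0} (ball 0 (√2 * ρ)) =
        ENNReal.ofReal (√2 * (stripPoly 0 ρ - stripPoly 0 1) + Real.pi ^ 4) ∧
      perim {x | outerDist (biNorm x).swap ≤ 0} (ball 0 (√2 * ρ)) =
        ENNReal.ofReal (√2 * (stripPoly 0 ρ - stripPoly 0 1) + Real.pi ^ 4) :=
  ⟨perim_biradial diagDist_coeff (by norm_num) (by positivity) (fun _ => rfl)
      (tendsto_layer_outer (by linarith)) fun κ hκ => bad_layer_outer hρ hκ,
    perim_biradial_swap diagDist_coeff (by norm_num) (by positivity) (fun _ => rfl)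
      (tendsto_layer_outer (by linarith)) fun κ hκ => bad_layer_outer hρ hκ⟩

/-- The function whose nonpositivity describes the barrel. -/
def barrelDist (p : ℝ × ℝ) : ℝ := max (aff 1 0 1 p) (aff 0 1 1 p)

lemma barrelDist_pos {p : ℝ × ℝ} : 0 < barrelDist p ↔ 1 < p.1 ∨ 1 < p.2 := by
  simp [barrelDist, aff]

lemma barrelDist_lt {p : ℝ × ℝ} {ε : ℝ} :
    barrelDist p < ε ↔ p.1 < 1 + ε ∧ p.2 < 1 + ε := by
  simp [barrelDist, aff, sub_lt_iff_lt_add']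

lemma tendsto_layer_barrel {r : ℝ} (hr : 3 ≤ r) :
    Tendsto (fun ε => biRad.real (planarLayer barrelDist r ε) / ε) (𝓝[>] 0)
      (𝓝 (2 * Real.pi ^ 4)) := by
  refine tendsto_div_of_bounds
    (f := fun ε => Real.pi ^ 4 / 2 * (4 + 6 * ε + 4 * ε ^ 2 + ε ^ 3))
    (g := fun ε => Real.pi ^ 4 / 2 * ((1 + ε) ^ 4 * (4 + 6 * ε + 4 * ε ^ 2 + ε ^ 3)))
    (by fun_prop) (by fun_prop) (by ring) (by ring) ?_ ?_
  · filter_upwards [eventually_pos_lt one_pos] with ε ⟨hε0, hε⟩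
    calc _ = biRad.real (Ioo 1 (1 + ε) ×ˢ Ioo 0 1) + biRad.real (Ioo 0 1 ×ˢ Ioo 1 (1 + ε)) := by
          rw [biRad_real_rect zero_le_one (by linarith) le_rfl zero_le_one,
            biRad_real_rect le_rfl zero_le_one zero_le_one (by linarith)]
          ring
      _ = biRad.real (Ioo 1 (1 + ε) ×ˢ Ioo 0 1 ∪ Ioo 0 1 ×ˢ Ioo 1 (1 + ε)) := by
          refine (measureReal_union ?_ (measurableSet_Ioo.prod measurableSet_Ioo)
            (biRad_rect_ne_top _ _ _ _) (biRad_rect_ne_top _ _ _ _)).symm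
          exact disjoint_left.2 fun p hp hp' => hp'.2.1.not_gt hp.2.2
      _ ≤ _ := by
          refine biRad_real_mono (biRad_ne_top 2 ?_) ?_
          · intro p hp
            have := barrelDist_lt.1 hp.2.2
            constructor <;> linarith [this.1, this.2]
          · intro p hp hp1 hp2
            rw [planarLayer, mem_ofPred_eq, barrelDist_pos, barrelDist_lt]
            rcases hp with ⟨⟨h0, h1⟩, h3, h4⟩ | ⟨⟨h0, h1⟩, h3, h4⟩
            · exact ⟨by nlinarith, Or.inl h0, h1, by linarith⟩
            · exact ⟨by nlinarith, Or.inr h3, by linarith, h4⟩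
  · filter_upwards [eventually_pos_lt one_pos] with ε ⟨hε0, hε⟩
    calc _ ≤ biRad.real (Ioo 1 (1 + ε) ×ˢ Ioo 0 (1 + ε) ∪ Ioo 0 (1 + ε) ×ˢ Ioo 1 (1 + ε)) := by
          refine biRad_real_mono
            (measure_union_ne_top (biRad_rect_ne_top _ _ _ _) (biRad_rect_ne_top _ _ _ _)) ?_
          rintro p ⟨h1, h3, h4⟩ hp1 hp2
          rw [barrelDist_lt] at h4
          rcases barrelDist_pos.1 h3 with h | h
          · exact Or.inl ⟨⟨h, h4.1⟩, hp2, h4.2⟩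
          · exact Or.inr ⟨⟨hp1, h4.1⟩, h, h4.2⟩
      _ ≤ biRad.real (Ioo 1 (1 + ε) ×ˢ Ioo 0 (1 + ε)) +
          biRad.real (Ioo 0 (1 + ε) ×ˢ Ioo 1 (1 + ε)) := measureReal_union_le _ _
      _ = _ := by
          rw [biRad_real_rect zero_le_one (by linarith) le_rfl (by linarith),
            biRad_real_rect le_rfl (by linarith) zero_le_one (by linarith)]
          ring

lemma bad_layer_barrel {r : ℝ} (hr : 3 ≤ r) {κ : ℝ} (hκ : 0 < κ) :
    ∃ δ > 0, δ < r ∧ ∀ᶠ ε in 𝓝[>] (0 : ℝ),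
      biRad.real (planarLayer barrelDist r ε ∩ badSet (aff 1 0 1) (aff 0 1 1) r δ) ≤ κ * ε := by
  set N := 256 * Real.pi ^ 4 with hN
  have hN0 : 0 < N := by positivity
  set δ := min (1 / 4) (κ / (12 * N)) with hδ
  have hδ0 : 0 < δ := by positivity
  have hδ1 : δ ≤ 1 / 4 := min_le_left _ _
  have hδκ : 12 * N * δ ≤ κ := by
    have := min_le_right (1 / 4) (κ / (12 * N))
    rw [← hδ, le_div_iff₀ (by positivity)] at this
    linarith
  refine ⟨δ, hδ0, by linarith, ?_⟩
  filter_upwards [eventually_pos_lt (c := δ) (by positivity)] with ε ⟨hε0, hε⟩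
  calc _ ≤ biRad.real ((Ioo 1 (1 + ε) ×ˢ Ioo 0 (2 * δ) ∪
          Ioo 1 (1 + ε) ×ˢ Ioo (1 - 2 * δ) (1 + 2 * δ)) ∪
        (Ioo 0 (2 * δ) ×ˢ Ioo 1 (1 + ε) ∪ Ioo (1 - 2 * δ) (1 + 2 * δ) ×ˢ Ioo 1 (1 + ε))) := by
        refine biRad_real_mono
          (measure_union_ne_top
            (measure_union_ne_top (biRad_rect_ne_top _ _ _ _) (biRad_rect_ne_top _ _ _ _))
            (measure_union_ne_top (biRad_rect_ne_top _ _ _ _) (biRad_rect_ne_top _ _ _ _))) ?_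
        rintro p ⟨⟨h1, h3, h4⟩, hb⟩ hp1 hp2
        rw [barrelDist_pos] at h3
        obtain ⟨h4, h5⟩ := barrelDist_lt.1 h4
        have hball : ¬(r - δ) ^ 2 ≤ p.1 ^ 2 + p.2 ^ 2 := by nlinarith
        have e : aff 1 0 1 p - aff 0 1 1 p = p.1 - p.2 := by
          simp only [aff]
          ring
        rw [badSet, mem_ofPred_eq, e, abs_le] at hb
        rcases h3 with h3 | h3
        · left
          rcases hb with hb | hb | hb | hb
          · linarith
          · exact Or.inl ⟨⟨h3, h4⟩, hp2, by linarith⟩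
          · exact absurd hb hball
          · exact Or.inr ⟨⟨h3, h4⟩, by linarith, by linarith⟩
        · right
          rcases hb with hb | hb | hb | hb
          · exact Or.inl ⟨⟨hp1, by linarith⟩, h3, h5⟩
          · linarith
          · exact absurd hb hball
          · exact Or.inr ⟨⟨by linarith, by linarith⟩, h3, h5⟩
    _ ≤ (N * ((1 + ε - 1) * (2 * δ - 0)) + N * ((1 + ε - 1) * (1 + 2 * δ - (1 - 2 * δ)))) +
        (N * ((2 * δ - 0) * (1 + ε - 1)) + N * ((1 + 2 * δ - (1 - 2 * δ)) * (1 + ε - 1))) := by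
        refine (measureReal_union_le _ _).trans (add_le_add
          ((measureReal_union_le _ _).trans (add_le_add ?_ ?_))
          ((measureReal_union_le _ _).trans (add_le_add ?_ ?_))) <;>
        apply rect_le <;> linarith
    _ = 12 * N * δ * ε := by ring
    _ ≤ κ * ε := by gcongr

lemma perim_biradial_barrel {r : ℝ} (hr : 3 ≤ r) :
    perim {x | barrelDist (biNorm x) ≤ 0} (ball 0 r) = ENNReal.ofReal (2 * Real.pi ^ 4) :=
  perim_biradial (by norm_num) (by norm_num) (by linarith) (fun _ => rfl)
    (tendsto_layer_barrel hr) fun _ hκ => bad_layer_barrel hr hκ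

lemma ae_biRad_generic : ∀ᵐ p ∂biRad, p.1 ≠ p.2 ∧ p.1 ≠ 1 ∧ p.2 ≠ 1 := by
  have h : ∀ᵐ t ∂rad, t ≠ 1 := by
    rw [ae_iff]
    simp
  have hd : ∀ᵐ p ∂rad.prod rad, p.1 ≠ p.2 := by
    refine (Measure.ae_prod_iff_ae_ae
      (measurableSet_eq_fun measurable_fst measurable_snd).compl).2 ?_
    refine ae_of_all _ fun s => ?_
    rw [ae_iff]
    simp
  rw [biRad_eq_prod]
  filter_upwards [hd, Measure.quasiMeasurePreserving_fst.ae h,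
    Measure.quasiMeasurePreserving_snd.ae h] with p h0 h1 h2 using ⟨h0, h1, h2⟩

lemma ae_generic : ∀ᵐ x : Euc 8, nlo x ≠ nhi x ∧ nlo x ≠ 1 ∧ nhi x ≠ 1 :=
  ae_of_ae_map continuous_biNorm.measurable.aemeasurable ae_biRad_generic

lemma perim_empty {d : ℕ} (B : Set (Euc d)) : perim ∅ B = 0 := by
  refine le_antisymm ((iInf₂_le univ isOpen_univ).trans ((iInf_le _ (subset_univ B)).trans ?_))
    zero_le
  simp

lemma diagDist_nonpos {p : ℝ × ℝ} : diagDist p ≤ 0 ↔ p.1 ≤ p.2 := by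
  rw [← not_lt, diagDist_pos, not_lt]

lemma outerDist_nonpos {p : ℝ × ℝ} : outerDist p ≤ 0 ↔ p.1 ≤ p.2 ∧ 1 ≤ p.2 := by
  rw [← not_lt, outerDist_pos, not_or, not_lt, not_lt]

lemma perim_simonsPart {ρ : ℝ} (hρ : 2 ≤ ρ) :
    perim (SimonsPart 1) (ball 0 (√2 * ρ)) = ENNReal.ofReal (√2 * stripPoly 0 ρ) ∧
      perim (SimonsPart 2) (ball 0 (√2 * ρ)) = ENNReal.ofReal (√2 * stripPoly 0 ρ) := by
  obtain ⟨h1, h2⟩ := perim_biradial_diag hρ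
  refine ⟨(perim_congr_ae (eventuallyEq_set.2 (ae_of_all _ fun x => ?_)) _).trans h1,
    (perim_congr_ae (eventuallyEq_set.2 ?_) _).trans h2⟩
  · exact (diagDist_nonpos (p := biNorm x)).symm
  · filter_upwards [ae_generic] with x hx
    refine Iff.trans ?_ diagDist_nonpos.symm
    exact ⟨fun h => le_of_lt h, fun h => lt_of_le_of_ne h hx.1.symm⟩

lemma perim_barrelPart_outer {ρ : ℝ} (hρ : 3 ≤ ρ) :
    perim (barrelPart 1) (ball 0 (√2 * ρ)) =
        ENNReal.ofReal (√2 * (stripPoly 0 ρ - stripPoly 0 1) + Real.pi ^ 4) ∧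
      perim (barrelPart 2) (ball 0 (√2 * ρ)) =
        ENNReal.ofReal (√2 * (stripPoly 0 ρ - stripPoly 0 1) + Real.pi ^ 4) := by
  obtain ⟨h1, h2⟩ := perim_biradial_outer hρ
  refine ⟨(perim_congr_ae (eventuallyEq_set.2 ?_) _).trans h1,
    (perim_congr_ae (eventuallyEq_set.2 ?_) _).trans h2⟩
  · filter_upwards [ae_generic] with x ⟨_, hx1, hx2⟩
    refine Iff.trans ?_ outerDist_nonpos.symm
    change nlo x ≤ nhi x ∧ ¬(nlo x ≤ 1 ∧ nhi x ≤ 1) ↔ nlo x ≤ nhi x ∧ 1 ≤ nhi x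
    grind
  · filter_upwards [ae_generic] with x ⟨hx, hx1, hx2⟩
    refine Iff.trans ?_ outerDist_nonpos.symm
    change nhi x < nlo x ∧ ¬(nlo x ≤ 1 ∧ nhi x ≤ 1) ↔ nhi x ≤ nlo x ∧ 1 ≤ nlo x
    grind

lemma perim_barrelRegion {r : ℝ} (hr : 3 ≤ r) :
    perim barrelRegion (ball 0 r) = ENNReal.ofReal (2 * Real.pi ^ 4) := by
  rw [← perim_biradial_barrel hr]
  congr 1
  ext x
  change nlo x ≤ 1 ∧ nhi x ≤ 1 ↔ barrelDist (biNorm x) ≤ 0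
  rw [← not_lt (b := barrelDist _), barrelDist_pos, not_or, not_lt, not_lt]
  rfl

lemma volume_real_barrelRegion : volume.real barrelRegion = Real.pi ^ 4 / 4 := by
  have h : barrelRegion = biNorm ⁻¹' (Iic 1 ×ˢ Iic 1) := rfl
  rw [h, ← biRad_real_apply (measurableSet_Iic.prod measurableSet_Iic), biRad_real_prod,
    rad_real_Iic zero_le_one]
  ring

lemma stripPoly_zero (t : ℝ) : stripPoly 0 t = 4 / 7 * Real.pi ^ 4 * t ^ 7 := by
  simp only [stripPoly]
  ring

lemma partPerim_sub {ρ : ℝ} (hρ : 3 ≤ ρ) :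
    (partPerim barrelPart (ball 0 (√2 * ρ))).toReal -
      (partPerim SimonsPart (ball 0 (√2 * ρ))).toReal =
        2 * Real.pi ^ 4 - 4 / 7 * √2 * Real.pi ^ 4 := by
  have h2 := sqrt_two_bounds
  obtain ⟨s1, s2⟩ := perim_simonsPart (show 2 ≤ ρ by linarith)
  obtain ⟨b1, b2⟩ := perim_barrelPart_outer hρ
  have b0 : perim (barrelPart 0) (ball 0 (√2 * ρ)) = _ :=
    perim_barrelRegion (show 3 ≤ √2 * ρ by nlinarith)
  have s0 : perim (SimonsPart 0) (ball 0 (√2 * ρ)) = 0 := perim_empty _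
  have hmono : (1 : ℝ) ^ 7 ≤ ρ ^ 7 := pow_le_pow_left₀ zero_le_one (by linarith) 7
  have hsub : 0 ≤ stripPoly 0 ρ - stripPoly 0 1 := by
    rw [stripPoly_zero, stripPoly_zero, ← mul_sub]
    exact mul_nonneg (by positivity) (by linarith)
  have hpos : 0 ≤ √2 * stripPoly 0 ρ := by
    rw [stripPoly_zero]
    positivity
  rw [partPerim, partPerim, Fin.sum_univ_three, Fin.sum_univ_three, b0, b1, b2, s0, s1, s2,
    zero_add, ← ENNReal.ofReal_add (by positivity) (by positivity),
    ← ENNReal.ofReal_add (by positivity) (by positivity), ← ENNReal.ofReal_add hpos hpos,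
    ENNReal.toReal_div, ENNReal.toReal_div, ENNReal.toReal_ofReal (by positivity),
    ENNReal.toReal_ofReal (by positivity), stripPoly_zero 1, ENNReal.toReal_ofNat]
  ring

lemma defect_value :
    (2 * Real.pi ^ 4 - 4 / 7 * √2 * Real.pi ^ 4) / (Real.pi ^ 4 / 4) ^ ((7 : ℝ) / 8) =
      (8 : ℝ) ^ ((1 : ℝ) / 4) * √Real.pi * (4 - (8 / 7) * √2) := by
  have hp := Real.pi_pos
  have h4 : (4 : ℝ) ^ ((7 : ℝ) / 8) = 2 * (8 : ℝ) ^ ((1 : ℝ) / 4) := by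
    rw [show (4 : ℝ) = 2 ^ (2 : ℝ) by norm_num, show (8 : ℝ) = 2 ^ (3 : ℝ) by norm_num,
      ← Real.rpow_mul two_pos.le, ← Real.rpow_mul two_pos.le]
    conv_rhs => rw [← Real.rpow_one_add' two_pos.le (by norm_num)]
    norm_num
  have hpi : (Real.pi ^ 4) ^ ((7 : ℝ) / 8) * √Real.pi = Real.pi ^ 4 := by
    rw [Real.sqrt_eq_rpow, ← Real.rpow_natCast, ← Real.rpow_mul hp.le, ← Real.rpow_add hp]
    norm_num
  rw [Real.div_rpow (by positivity) (by norm_num), h4]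
  have ha : 0 < (Real.pi ^ 4) ^ ((7 : ℝ) / 8) := by positivity
  generalize (Real.pi ^ 4) ^ ((7 : ℝ) / 8) = a at *
  rw [← hpi]
  field_simp
  ring

/-- **Defect of the barrel partition of `ℝ⁸`** (its blow-down is the Simons' cone
partition). -/
theorem barrel_defect :
    liminf (fun r : ℝ =>
        ((partPerim barrelPart (ball 0 r)).toReal -
          (partPerim SimonsPart (ball 0 r)).toReal) /
          (volume (barrelPart 0)).toReal ^ ((7 : ℝ) / 8)) atTop
      = (8 : ℝ) ^ ((1 : ℝ) / 4) * Real.sqrt Real.pi * (4 - (8 / 7) * Real.sqrt 2) := by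
  rw [← defect_value]
  refine Tendsto.liminf_eq (tendsto_const_nhds.congr' ?_)
  filter_upwards [eventually_ge_atTop (√2 * 3)] with r hr
  have hv : (volume (barrelPart 0)).toReal = Real.pi ^ 4 / 4 := volume_real_barrelRegion
  have hr' : r = √2 * (r / √2) := by field_simp
  rw [hv, hr', partPerim_sub ((le_div_iff₀' (by positivity)).2 hr)]
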